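/- arXiv:2309.12092 — 4 statements merged into one kernel-verified Lean document; each statement's English description precedes it below -/
import Mathlib

section
/- Let K and C be convex bodies in the plane, with C Minkowski-centered (i.e., C ⊂opt −s(C)C where s(C) = R(C,−C) is the Minkowski asymmetry). Then D_MAX(K,C) ≥ R(K,C). -/
open Pointwise Set

variable {V : Type*} [NormedAddCommGroup V] [NormedSpace ℝ V]

/-- Circumradius `R(K,C) = inf {ρ ≥ 0 : ∃ t, K ⊆ t + ρC}`. -/
noncomputable def circumradius (K C : Set V) : ℝ :=
  sInf {ρ : ℝ | 0 ≤ ρ ∧ ∃ t : V, K ⊆ t +ᵥ ρ • C}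

/-- Inradius `r(K,C) = sup {ρ ≥ 0 : ∃ t, t + ρC ⊆ K}`. -/
noncomputable def inradius (K C : Set V) : ℝ :=
  sSup {ρ : ℝ | 0 ≤ ρ ∧ ∃ t : V, t +ᵥ ρ • C ⊆ K}

/-- Optimal containment: `K ⊆ C` and `R(K,C) = 1`. -/
def OptCont (K C : Set V) : Prop := K ⊆ C ∧ circumradius K C = 1

/-- Minkowski asymmetry `s(C) = R(C, -C)`. -/
noncomputable def minkAsym (C : Set V) : ℝ := circumradius C (-C)

/-- `C` is Minkowski-centered if `C ⊆opt s(C) • (-C)`. -/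
def MinkowskiCentered (C : Set V) : Prop := OptCont C (minkAsym C • (-C))

/-- Arithmetic symmetrization `(K - K)/2`. -/
def symAM (K : Set V) : Set V := (2 : ℝ)⁻¹ • (K - K)

/-- Maximum symmetrization `conv (C ∪ -C)`. -/
def symMAX (C : Set V) : Set V := convexHull ℝ (C ∪ -C)

/-- Minimum symmetrization `C ∩ -C`. -/
def symMIN (C : Set V) : Set V := C ∩ -C

/-- The maximum diameter `D_MAX(K,C) = 2 R((K-K)/2, conv(C ∪ -C))`. -/
noncomputable def DMAX (K C : Set V) : ℝ := 2 * circumradius (symAM K) (symMAX C)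

/-- The minimum diameter `D_MIN(K,C) = 2 R((K-K)/2, C ∩ -C)`. -/
noncomputable def DMIN (K C : Set V) : ℝ := 2 * circumradius (symAM K) (symMIN C)

/-- A body is complete (w.r.t. a diameter functional `D`) if every strictly larger
convex body has strictly larger diameter. -/
def IsCompleteBody (D : Set V → ℝ) (K : Set V) : Prop :=
  ∀ K' : Set V, Convex ℝ K' → IsCompact K' → K ⊂ K' → D K < D K'

/-- `Kstar` is a completion of `K` w.r.t. the diameter functional `D`. -/
def IsCompletion (D : Set V → ℝ) (K Kstar : Set V) : Prop :=
  K ⊆ Kstar ∧ Convex ℝ Kstar ∧ IsCompact Kstar ∧ IsCompleteBody D Kstar ∧ D Kstar = D K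

theorem jung_tau_aux (m1 m2 m3 : ℝ) (h1 : 0 ≤ m1) (h1' : m1 ≤ 1) (h2 : 0 ≤ m2) (h2' : m2 ≤ 1)
    (h3 : 0 ≤ m3) (h3' : m3 ≤ 1) :
    ∃ t1 t2 t3 : ℝ, 0 ≤ t1 ∧ 0 ≤ t2 ∧ 0 ≤ t3 ∧ t1 + t2 + t3 = 1 ∧
      t2 * (2 - m3) + t3 * (1 + m2) ≤ 1 ∧ t3 * (2 - m1) + t1 * (1 + m3) ≤ 1 ∧
      t1 * (2 - m2) + t2 * (1 + m1) ≤ 1 := by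
  obtain ⟨b1, rfl⟩ : ∃ b, m1 = (3 * b + 1) / 2 := ⟨(2 * m1 - 1) / 3, by ring⟩
  obtain ⟨b2, rfl⟩ : ∃ b, m2 = (3 * b + 1) / 2 := ⟨(2 * m2 - 1) / 3, by ring⟩
  obtain ⟨b3, rfl⟩ : ∃ b, m3 = (3 * b + 1) / 2 := ⟨(2 * m3 - 1) / 3, by ring⟩
  have key : ∀ x y z : ℝ, -(1/3) ≤ x → x ≤ 1/3 → -(1/3) ≤ y → y ≤ 1/3 → -(1/3) ≤ z → z ≤ 1/3 →
      0 ≤ 1 + x * (x + y + z) + y - z := by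
    intro x y z a1 a2 a3 a4 a5 a6
    nlinarith [sq_nonneg (x + (y + z) / 2), mul_nonneg (by linarith : 0 ≤ 2/3 - (y+z))
      (by linarith : 0 ≤ 2/3 + (y + z))]
  have k1 := key b1 b2 b3 (by linarith) (by linarith) (by linarith) (by linarith) (by linarith)
    (by linarith)
  have k2 := key b2 b3 b1 (by linarith) (by linarith) (by linarith) (by linarith) (by linarith)
    (by linarith)
  have k3 := key b3 b1 b2 (by linarith) (by linarith) (by linarith) (by linarith) (by linarith)
    (by linarith)
  have hD : 0 < 3 + (b1 + b2 + b3) ^ 2 := by positivity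
  refine ⟨(1 + b1 * (b1 + b2 + b3) + b2 - b3) / (3 + (b1 + b2 + b3) ^ 2),
    (1 + b2 * (b2 + b3 + b1) + b3 - b1) / (3 + (b1 + b2 + b3) ^ 2),
    (1 + b3 * (b3 + b1 + b2) + b1 - b2) / (3 + (b1 + b2 + b3) ^ 2),
    by positivity, by positivity, by positivity, ?_, ?_, ?_, ?_⟩
  · rw [← add_div, ← add_div, div_eq_one_iff_eq hD.ne']; ring
  all_goals
    rw [div_mul_eq_mul_div, div_mul_eq_mul_div, ← add_div, div_le_one hD]
    nlinarith [sq_nonneg (b1 - b2), sq_nonneg (b2 - b3), sq_nonneg (b1 - b3)]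

theorem jung_helly_aux {S : Set (EuclideanSpace ℝ (Fin 2))}
    (F : EuclideanSpace ℝ (Fin 2) → Set (EuclideanSpace ℝ (Fin 2)))
    (hconv : ∀ x, Convex ℝ (F x)) (hcomp : ∀ x, IsCompact (F x)) (hS : S.Nonempty)
    (h : ∀ a ∈ S, ∀ b ∈ S, ∀ c ∈ S, ∃ t, t ∈ F a ∧ t ∈ F b ∧ t ∈ F c) :
    ∃ t, ∀ x ∈ S, t ∈ F x := by
  classical
  have := Convex.helly_theorem_compact' (𝕜 := ℝ) (F := fun x : S => F x)
    (fun i => hconv i) (fun i => hcomp i) (by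
      intro I hI
      rw [finrank_euclideanSpace_fin] at hI
      obtain ⟨s0, hs0⟩ := hS
      have : ∃ a b c : S, I ⊆ {a, b, c} := by
        interval_cases hc : I.card
        · rw [Finset.card_eq_zero] at hc
          exact ⟨⟨s0, hs0⟩, ⟨s0, hs0⟩, ⟨s0, hs0⟩, by simp [hc]⟩
        · obtain ⟨a, rfl⟩ := Finset.card_eq_one.1 hc
          exact ⟨a, a, a, by simp⟩
        · obtain ⟨a, b, _, rfl⟩ := Finset.card_eq_two.1 hc
          exact ⟨a, b, b, by simp⟩
        · obtain ⟨a, b, c, _, _, _, rfl⟩ := Finset.card_eq_three.1 hc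
          exact ⟨a, b, c, subset_rfl⟩
      obtain ⟨a, b, c, hsub⟩ := this
      obtain ⟨t, h1, h2, h3⟩ := h a a.2 b b.2 c c.2
      refine ⟨t, ?_⟩
      simp only [mem_iInter]
      intro i hi
      have := hsub hi
      simp only [Finset.mem_insert, Finset.mem_singleton] at this
      rcases this with rfl | rfl | rfl <;> assumption)
  obtain ⟨t, ht⟩ := this
  rw [mem_iInter] at ht
  exact ⟨t, fun x hx => ht ⟨x, hx⟩⟩

theorem jung_asym_aux (C : Set (EuclideanSpace ℝ (Fin 2)))
    (hCconv : Convex ℝ C) (hCcomp : IsCompact C) (hne : C.Nonempty) : minkAsym C ≤ 2 := by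
  obtain ⟨t, ht⟩ := jung_helly_aux (S := C) (fun x => x +ᵥ (2 : ℝ) • C)
    (fun x => (hCconv.smul 2).vadd x) (fun x => (hCcomp.smul (2 : ℝ)).vadd x) hne (by
      have key : ∀ a ∈ C, ∀ b ∈ C, ∀ c ∈ C, a + b + c ∈ a +ᵥ (2 : ℝ) • C := by
        intro a _ b hb c hc
        refine ⟨b + c, ⟨(1/2 : ℝ) • b + (1/2 : ℝ) • c, hCconv hb hc (by norm_num) (by norm_num)
          (by norm_num), ?_⟩, ?_⟩
        · simp only; module
        · simp only [vadd_eq_add]; abel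
      intro a ha b hb c hc
      refine ⟨a + b + c, key a ha b hb c hc, ?_, ?_⟩
      · have := key b hb a ha c hc
        rwa [show b + a + c = a + b + c by abel] at this
      · have := key c hc a ha b hb
        rwa [show c + a + b = a + b + c by abel] at this)
  apply csInf_le ⟨0, fun r hr => hr.1⟩
  refine ⟨by norm_num, t, ?_⟩
  intro x hx
  obtain ⟨y, ⟨z, hz, rfl⟩, hy⟩ := ht x hx
  refine ⟨(2 : ℝ) • (-z), ⟨-z, by simpa using hz, rfl⟩, ?_⟩
  simp only [vadd_eq_add] at hy ⊢
  rw [← hy]; module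

theorem jung_comb_aux {V : Type*} [AddCommGroup V] [Module ℝ V] {C : Set V} (hC : Convex ℝ C)
    (h0 : (0 : V) ∈ C) {p q r s : V} (hp : p ∈ C) (hq : q ∈ C) (hr : r ∈ C) (hs : s ∈ C)
    {a b c d : ℝ} (ha : 0 ≤ a) (hb : 0 ≤ b) (hc : 0 ≤ c) (hd : 0 ≤ d) (h : a + b + c + d ≤ 1) :
    a • p + b • q + c • r + d • s ∈ C := by
  have := hC.sum_mem (t := Finset.univ) (w := ![a, b, c, d, 1 - (a + b + c + d)])
    (z := ![p, q, r, s, 0]) (by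
      intro i _; fin_cases i <;> simp <;> linarith) (by
      simp [Fin.sum_univ_succ]; ring) (by
      intro i _; fin_cases i <;> simp <;> assumption)
  simpa [Fin.sum_univ_succ, add_assoc] using this

theorem jung_tri_aux {V : Type*} [AddCommGroup V] [Module ℝ V] {C : Set V} (hC : Convex ℝ C)
    (h0 : (0 : V) ∈ C) (h2 : ∀ c ∈ C, ∃ c' ∈ C, -c = (2 : ℝ) • c') (r : ℝ) (x y z : V)
    (h : ∀ u v : V, u ∈ ({x, y, z} : Set V) → v ∈ ({x, y, z} : Set V) →
      ∃ m : ℝ, 0 ≤ m ∧ m ≤ 1 ∧ ∃ p ∈ C, ∃ q ∈ C, u - v = r • (m • p - (1 - m) • q)) :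
    ∃ t, ∀ u ∈ ({x, y, z} : Set V), ∃ c ∈ C, u - t = r • c := by
  obtain ⟨m1, a1, b1, p1, hp1, q1, hq1, e1⟩ := h y z (by simp) (by simp)
  obtain ⟨m2, a2, b2, p2, hp2, q2, hq2, e2⟩ := h z x (by simp) (by simp)
  obtain ⟨m3, a3, b3, p3, hp3, q3, hq3, e3⟩ := h x y (by simp) (by simp)
  obtain ⟨t1, t2, t3, ht1, ht2, ht3, hs, i1, i2, i3⟩ :=
    jung_tau_aux m1 m2 m3 a1 b1 a2 b2 a3 b3
  have key : ∀ (m n s t : ℝ) (p q p' q' : V), p ∈ C → q ∈ C → p' ∈ C → q' ∈ C →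
      0 ≤ m → m ≤ 1 → 0 ≤ n → n ≤ 1 → 0 ≤ s → 0 ≤ t → s * (2 - m) + t * (1 + n) ≤ 1 →
      ∃ c ∈ C, s • (r • (m • p - (1 - m) • q)) - t • (r • (n • p' - (1 - n) • q')) = r • c := by
    intro m n s t p q p' q' hp hq hp' hq' hm hm' hn hn' hs ht hi
    obtain ⟨c, hc, ec⟩ := h2 q hq
    obtain ⟨d, hd, ed⟩ := h2 p' hp'
    have hm1 : 0 ≤ 1 - m := by linarith
    have hn1 : 0 ≤ 1 - n := by linarith
    refine ⟨(s * m) • p + (s * (1 - m) * 2) • c + (t * n * 2) • d + (t * (1 - n)) • q',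
      jung_comb_aux hC h0 hp hc hd hq' (by positivity) (by positivity) (by positivity)
        (by positivity) (by linarith), ?_⟩
    obtain rfl : q = -((2 : ℝ) • c) := by rw [← ec]; simp
    obtain rfl : p' = -((2 : ℝ) • d) := by rw [← ed]; simp
    module
  have ht : t1 = 1 - t2 - t3 := by linarith
  refine ⟨t1 • x + t2 • y + t3 • z, ?_⟩
  intro u hu
  rcases hu with rfl | rfl | rfl
  · obtain ⟨c, hc, ec⟩ := key m3 m2 t2 t3 p3 q3 p2 q2 hp3 hq3 hp2 hq2 a3 b3 a2 b2 ht2 ht3 i1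
    refine ⟨c, hc, ?_⟩
    rw [← ec, ← e3, ← e2, ht]; module
  · obtain ⟨c, hc, ec⟩ := key m1 m3 t3 t1 p1 q1 p3 q3 hp1 hq1 hp3 hq3 a1 b1 a3 b3 ht3 ht1 i2
    refine ⟨c, hc, ?_⟩
    rw [← ec, ← e3, ← e1, ht]; module
  · obtain ⟨c, hc, ec⟩ := key m2 m1 t1 t2 p2 q2 p1 q1 hp2 hq2 hp1 hq1 a2 b2 a1 b1 ht1 ht2 i3
    refine ⟨c, hc, ?_⟩
    rw [← ec, ← e1, ← e2, ht]; module

theorem jung_feasible_aux (K C : Set (EuclideanSpace ℝ (Fin 2))) (hK : IsCompact K)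
    (hCfd : (interior C).Nonempty) : ∃ ρ : ℝ, 0 ≤ ρ ∧ ∃ t : EuclideanSpace ℝ (Fin 2), symAM K ⊆ t +ᵥ ρ • symMAX C := by
  obtain ⟨x, hx⟩ := hCfd
  obtain ⟨ε, hε, hball⟩ := Metric.isOpen_iff.1 isOpen_interior x hx
  have hb : Bornology.IsBounded (symAM K) := by
    unfold symAM
    rw [sub_eq_add_neg]
    exact ((hK.add hK.neg).smul (2 : ℝ)⁻¹).isBounded
  obtain ⟨M, hM0, hM⟩ := hb.exists_pos_norm_lt
  refine ⟨M / ε, by positivity, -((M / ε) • x), ?_⟩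
  intro y hy
  have h1 : x + (ε / M) • y ∈ C := by
    apply interior_subset
    apply hball
    rw [Metric.mem_ball, dist_eq_norm, add_sub_cancel_left, norm_smul, Real.norm_of_nonneg
      (by positivity), div_mul_eq_mul_div, div_lt_iff₀ hM0]
    exact mul_lt_mul_of_pos_left (hM y hy) hε
  refine ⟨(M / ε) • (x + (ε / M) • y), ⟨_, subset_convexHull ℝ _ (Or.inl h1), rfl⟩, ?_⟩
  simp only [vadd_eq_add, smul_add, smul_smul]
  rw [show M / ε * (ε / M) = 1 by field_simp]
  module

/-- Jung-type inequality in the plane: for a Minkowski-centered gauge `C`,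
`D_MAX(K,C) ≥ R(K,C)`. -/
theorem jung_DMAX_minkowski_centered (K C : Set (EuclideanSpace ℝ (Fin 2)))
    (hKconv : Convex ℝ K) (hKcomp : IsCompact K) (hKne : K.Nonempty)
    (hCconv : Convex ℝ C) (hCcomp : IsCompact C) (hCfd : (interior C).Nonempty)
    (hMC : MinkowskiCentered C) :
    circumradius K C ≤ DMAX K C := by
  have hCne : C.Nonempty := hCfd.mono interior_subset
  have hs2 := jung_asym_aux C hCconv hCcomp hCne
  have hs0 : 0 ≤ minkAsym C := Real.sInf_nonneg (fun r hr => hr.1)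
  have hsub := hMC.1
  have h0 : (0 : EuclideanSpace ℝ (Fin 2)) ∈ C := by
    obtain ⟨c, hc⟩ := hCne
    obtain ⟨d, hd, e⟩ := hsub hc
    have hd' : -d ∈ C := by simpa using hd
    have h1 : 0 < 1 + minkAsym C := by linarith
    have := hCconv hc hd' (a := 1 / (1 + minkAsym C)) (b := minkAsym C / (1 + minkAsym C))
      (by positivity) (by positivity) (by field_simp)
    convert this using 1
    simp only at e
    rw [← e, smul_neg, smul_smul, div_mul_eq_mul_div, one_mul]
    simp
  have h2 : ∀ c ∈ C, ∃ c' ∈ C, -c = (2 : ℝ) • c' := by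
    intro c hc
    obtain ⟨d, hd, e⟩ := hsub hc
    have hd' : -d ∈ C := by simpa using hd
    refine ⟨(minkAsym C / 2) • (-d), ?_, ?_⟩
    · exact hCconv.smul_mem_of_zero_mem h0 hd' ⟨by positivity, by linarith⟩
    · simp only at e
      rw [← e]; module
  have main : ∀ ρ : ℝ, 0 ≤ ρ → (∃ t : EuclideanSpace ℝ (Fin 2), symAM K ⊆ t +ᵥ ρ • symMAX C) →
      circumradius K C ≤ 2 * ρ := by
    rintro ρ hρ ⟨t, ht⟩
    have hdiff : ∀ u ∈ K, ∀ v ∈ K, ∃ m : ℝ, 0 ≤ m ∧ m ≤ 1 ∧ ∃ p ∈ C, ∃ q ∈ C,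
        u - v = (2 * ρ) • (m • p - (1 - m) • q) := by
      intro u hu v hv
      obtain ⟨_, ⟨a, ha, rfl⟩, ea⟩ := ht (smul_mem_smul_set (sub_mem_sub hu hv))
      obtain ⟨_, ⟨b, hb, rfl⟩, eb⟩ := ht (smul_mem_smul_set (sub_mem_sub hv hu))
      have hneg : -b ∈ symMAX C := by
        have : -symMAX C = symMAX C := by
          unfold symMAX
          rw [← convexHull_neg, union_neg, neg_neg, union_comm]
        rw [← this]; simpa using hb
      have hw : (1/2 : ℝ) • a + (1/2 : ℝ) • (-b) ∈ symMAX C :=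
        (convex_convexHull ℝ _) ha hneg (by norm_num) (by norm_num) (by norm_num)
      have huv : u - v = (2 * ρ) • ((1/2 : ℝ) • a + (1/2 : ℝ) • (-b)) := by
        simp only [vadd_eq_add] at ea eb
        have : u - v = (2 : ℝ)⁻¹ • (u - v) - (2 : ℝ)⁻¹ • (v - u) := by module
        rw [this, ← ea, ← eb]; module
      rw [huv]
      generalize (1/2 : ℝ) • a + (1/2 : ℝ) • (-b) = w at hw
      unfold symMAX at hw
      rw [hCconv.convexHull_union hCconv.neg hCne hCne.neg, mem_convexJoin] at hw
      obtain ⟨p, hp, q, hq, m, n, hm, hn, hmn, rfl⟩ := hw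
      refine ⟨m, hm, by linarith, p, hp, -q, by simpa using hq, ?_⟩
      rw [← hmn]; module
    obtain ⟨t', ht'⟩ := jung_helly_aux (S := K) (fun x => x +ᵥ (-(2 * ρ)) • C)
      (fun x => (hCconv.smul _).vadd x) (fun x => (hCcomp.smul (-(2 * ρ))).vadd x) hKne (by
        intro a ha b hb c hc
        have hK3 : ∀ u ∈ ({a, b, c} : Set (EuclideanSpace ℝ (Fin 2))), u ∈ K := by
          rintro u (rfl | rfl | rfl) <;> assumption
        obtain ⟨t, ht⟩ := jung_tri_aux hCconv h0 h2 (2 * ρ) a b c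
          (fun u v hu hv => hdiff u (hK3 u hu) v (hK3 v hv))
        have key : ∀ u ∈ ({a, b, c} : Set (EuclideanSpace ℝ (Fin 2))),
            t ∈ u +ᵥ (-(2 * ρ)) • C := by
          intro u hu
          obtain ⟨c, hc, e⟩ := ht u hu
          refine ⟨(-(2 * ρ)) • c, ⟨c, hc, rfl⟩, ?_⟩
          simp only [vadd_eq_add]
          rw [neg_smul, ← e]; abel
        exact ⟨t, key a (by simp), key b (by simp), key c (by simp)⟩)
    apply csInf_le ⟨0, fun r hr => hr.1⟩
    refine ⟨by positivity, t', ?_⟩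
    intro x hx
    obtain ⟨_, ⟨c, hc, rfl⟩, e⟩ := ht' x hx
    refine ⟨(2 * ρ) • c, ⟨c, hc, rfl⟩, ?_⟩
    simp only [vadd_eq_add] at e ⊢
    rw [← e]; module
  have : circumradius K C / 2 ≤ circumradius (symAM K) (symMAX C) := by
    apply le_csInf
    · obtain ⟨ρ, h⟩ := jung_feasible_aux K C hKcomp hCfd
      exact ⟨ρ, h⟩
    · rintro ρ ⟨h, h'⟩
      linarith [main ρ h h']
  unfold DMAX
  linarith
end

section
/- Let K, C be convex bodies in the plane with 0 ∈ C and C full-dimensional. Then D_MAX(K,C) ≥ (2/3)·R(K,C), and equality can be attained for some K if and only if C is a triangle with one vertex at the origin. -/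
open Pointwise Set

variable {V : Type*} [NormedAddCommGroup V] [NormedSpace ℝ V]

lemma vs_mem {t : V} {ρ : ℝ} {C : Set V} {p : V} :
    p ∈ t +ᵥ ρ • C ↔ ∃ x ∈ C, p = t + ρ • x := by
  constructor
  · rintro ⟨y, ⟨x, hx, rfl⟩, rfl⟩
    exact ⟨x, hx, rfl⟩
  · rintro ⟨x, hx, rfl⟩
    exact ⟨ρ • x, ⟨x, hx, rfl⟩, rfl⟩

lemma circ_nonempty {K C : Set V} (hK : IsCompact K) (hC : (interior C).Nonempty) :
    {ρ : ℝ | 0 ≤ ρ ∧ ∃ t : V, K ⊆ t +ᵥ ρ • C}.Nonempty := by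
  obtain ⟨c, hc⟩ := hC
  obtain ⟨ε, hε, hball⟩ := Metric.isOpen_iff.1 isOpen_interior c hc
  obtain ⟨B, hB⟩ := hK.isBounded.exists_norm_le
  refine ⟨2 * (|B| + 1) / ε, by positivity, -((2 * (|B| + 1) / ε) • c), fun p hp => ?_⟩
  rw [vs_mem]
  have hB0 : (0 : ℝ) < |B| + 1 := by positivity
  refine ⟨c + (2 * (|B| + 1) / ε)⁻¹ • p, interior_subset (hball ?_), ?_⟩
  · rw [Metric.mem_ball, dist_eq_norm, add_sub_cancel_left, norm_smul, Real.norm_eq_abs,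
      abs_of_pos (by positivity)]
    have h1 := hB p hp
    have h2 := le_abs_self B
    have : ‖p‖ < 2 * (|B| + 1) := by linarith
    calc (2 * (|B| + 1) / ε)⁻¹ * ‖p‖ < (2 * (|B| + 1) / ε)⁻¹ * (2 * (|B| + 1)) := by gcongr
      _ = ε := by field_simp
  · rw [smul_add, smul_smul, mul_inv_cancel₀ (by positivity), one_smul]
    abel

lemma circ_bdd (K C : Set V) : BddBelow {ρ : ℝ | 0 ≤ ρ ∧ ∃ t : V, K ⊆ t +ᵥ ρ • C} :=
  ⟨0, fun _ h => h.1⟩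

lemma circ_nonneg (K C : Set V) : 0 ≤ circumradius K C :=
  Real.sInf_nonneg fun _ h => h.1

lemma symMAX_mem {C : Set V} (hC : Convex ℝ C) (hne : C.Nonempty) {m : V} :
    m ∈ symMAX C ↔ ∃ x ∈ C, ∃ y ∈ C, ∃ a b : ℝ, 0 ≤ a ∧ 0 ≤ b ∧ a + b = 1 ∧
      m = a • x - b • y := by
  unfold symMAX
  rw [hC.convexHull_union hC.neg hne hne.neg, mem_convexJoin]
  constructor
  · rintro ⟨x, hx, y, hy, a, b, ha, hb, hab, rfl⟩
    exact ⟨x, hx, -y, hy, a, b, ha, hb, hab, by simp⟩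
  · rintro ⟨x, hx, y, hy, a, b, ha, hb, hab, rfl⟩
    exact ⟨x, hx, -y, by simpa using hy, a, b, ha, hb, hab, by simp [sub_eq_add_neg]⟩

lemma symMAX_neg {C : Set V} {m : V} (hm : m ∈ symMAX C) : -m ∈ symMAX C := by
  have : symMAX C = - symMAX C := by
    unfold symMAX
    rw [← convexHull_neg, Set.union_neg, neg_neg, Set.union_comm]
  rw [this]; simpa using hm

lemma symMAX_compact {C : Set V} (hC : Convex ℝ C) (hcomp : IsCompact C) (hne : C.Nonempty) :
    IsCompact (symMAX C) := by
  have : symMAX C = (fun q : (V × V) × ℝ => q.2 • q.1.1 - (1 - q.2) • q.1.2) ''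
      ((C ×ˢ C) ×ˢ Icc (0 : ℝ) 1) := by
    ext m
    rw [symMAX_mem hC hne]
    constructor
    · rintro ⟨x, hx, y, hy, a, b, ha, hb, hab, rfl⟩
      refine ⟨((x, y), a), ⟨⟨hx, hy⟩, ha, by linarith⟩, ?_⟩
      have : 1 - a = b := by linarith
      simp [this]
    · rintro ⟨⟨⟨x, y⟩, a⟩, ⟨⟨hx, hy⟩, ha, ha1⟩, rfl⟩
      exact ⟨x, hx, y, hy, a, 1 - a, ha, by linarith [show a ≤ 1 from ha1], by ring, rfl⟩
  rw [this]
  refine ((hcomp.prod hcomp).prod isCompact_Icc).image ?_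
  fun_prop

lemma symMAX_smul {C : Set V} (h0 : (0 : V) ∈ C) {m : V} (hm : m ∈ symMAX C) {a : ℝ}
    (ha : 0 ≤ a) (ha1 : a ≤ 1) : a • m ∈ symMAX C := by
  have h0' : (0 : V) ∈ symMAX C := subset_convexHull ℝ _ (Or.inl h0)
  exact (convex_convexHull ℝ _).smul_mem_of_zero_mem h0' hm ⟨ha, ha1⟩

/-- The diameter `DMAX` is attained. -/
lemma DMAX_mem {K C : Set V} (hC : Convex ℝ C) (hcomp : IsCompact C) (h0 : (0 : V) ∈ C)
    (hfd : (interior C).Nonempty) (hK : IsCompact K) {p q : V} (hp : p ∈ K) (hq : q ∈ K) :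
    ∃ m ∈ symMAX C, p - q = DMAX K C • m := by
  have hM : (interior (symMAX C)).Nonempty :=
    hfd.mono (interior_mono (fun x hx => subset_convexHull ℝ _ (Or.inl hx)))
  have hKK : IsCompact (symAM K) := by
    unfold symAM
    have : K - K = (fun z : V × V => z.1 - z.2) '' (K ×ˢ K) := by
      rw [Set.image_prod]; rfl
    rw [this]
    exact ((hK.prod hK).image (by fun_prop)).smul _
  have hne := circ_nonempty hKK hM
  set D := DMAX K C with hD
  have hDn : 0 ≤ D := by
    have := circ_nonneg (symAM K) (symMAX C)
    rw [hD, DMAX]; linarith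
  have key : ∀ ρ, D < ρ → ∃ m ∈ symMAX C, p - q = ρ • m := by
    intro ρ hρ
    have : sInf {ρ : ℝ | 0 ≤ ρ ∧ ∃ t : V, symAM K ⊆ t +ᵥ ρ • symMAX C} < ρ / 2 := by
      change circumradius _ _ < _
      rw [hD, DMAX] at hρ; linarith
    obtain ⟨r, ⟨hr0, t, ht⟩, hr⟩ := exists_lt_of_csInf_lt hne this
    have e1 : (2 : ℝ)⁻¹ • (p - q) ∈ symAM K := ⟨p - q, ⟨p, hp, q, hq, rfl⟩, rfl⟩
    have e2 : (2 : ℝ)⁻¹ • (q - p) ∈ symAM K := ⟨q - p, ⟨q, hq, p, hp, rfl⟩, rfl⟩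
    obtain ⟨m1, hm1, h1⟩ := vs_mem.1 (ht e1)
    obtain ⟨m2, hm2, h2⟩ := vs_mem.1 (ht e2)
    have hρ0 : 0 < ρ := lt_of_le_of_lt hDn hρ
    have hm : (2 : ℝ)⁻¹ • m1 + (2 : ℝ)⁻¹ • (-m2) ∈ symMAX C :=
      (convex_convexHull ℝ _) hm1 (symMAX_neg hm2) (by norm_num) (by norm_num) (by norm_num)
    refine ⟨(2 * r / ρ) • ((2 : ℝ)⁻¹ • m1 + (2 : ℝ)⁻¹ • (-m2)), symMAX_smul h0 hm (by positivity)
      (by rw [div_le_one hρ0]; linarith), ?_⟩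
    rw [smul_smul, mul_div_cancel₀ _ hρ0.ne']
    have : p - q = (2 : ℝ)⁻¹ • (p - q) - (2 : ℝ)⁻¹ • (q - p) := by module
    rw [this, h1, h2]
    module
  have hcl : IsClosed (Prod.fst '' ((Icc D (D + 1) ×ˢ symMAX C) ∩ {z : ℝ × V | p - q = z.1 • z.2})) := by
    apply IsCompact.isClosed
    apply IsCompact.image _ continuous_fst
    apply (isCompact_Icc.prod (symMAX_compact hC hcomp ⟨0, h0⟩)).inter_right
    exact isClosed_eq continuous_const (by fun_prop)
  have hsub : Ioo D (D + 1) ⊆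
      Prod.fst '' ((Icc D (D + 1) ×ˢ symMAX C) ∩ {z : ℝ × V | p - q = z.1 • z.2}) := by
    intro ρ hρ
    obtain ⟨m, hm, h⟩ := key ρ hρ.1
    exact ⟨(ρ, m), ⟨⟨⟨hρ.1.le, hρ.2.le⟩, hm⟩, h⟩, rfl⟩
  have hDcl : D ∈ closure (Ioo D (D + 1)) := by
    rw [closure_Ioo (by linarith)]
    exact ⟨le_refl _, by linarith⟩
  obtain ⟨⟨ρ, m⟩, ⟨⟨_, hm⟩, h⟩, rfl⟩ := (closure_minimal hsub hcl) hDcl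
  exact ⟨m, hm, h⟩

lemma card_three {α : Type*} [DecidableEq α] (I : Finset α) (a0 : α) (h : I.card ≤ 3) :
    ∃ a b c, I ⊆ {a, b, c} := by
  have : ∃ J : Finset α, I ⊆ J ∧ J.Nonempty ∧ J.card ≤ 3 := by
    rcases I.eq_empty_or_nonempty with rfl | hI
    · exact ⟨{a0}, by simp, by simp, by simp⟩
    · exact ⟨I, subset_rfl, hI, h⟩
  obtain ⟨J, hIJ, hJ, hc⟩ := this
  have hpos := hJ.card_pos
  have : J.card = 1 ∨ J.card = 2 ∨ J.card = 3 := by omega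
  rcases this with h | h | h
  · obtain ⟨a, rfl⟩ := Finset.card_eq_one.1 h
    exact ⟨a, a, a, by simpa using hIJ⟩
  · obtain ⟨a, b, -, rfl⟩ := Finset.card_eq_two.1 h
    exact ⟨a, b, b, by simpa using hIJ⟩
  · obtain ⟨a, b, c, -, -, -, rfl⟩ := Finset.card_eq_three.1 h
    exact ⟨a, b, c, hIJ⟩

lemma helly_sep [FiniteDimensional ℝ V] (hdim : Module.finrank ℝ V = 2) {K C : Set V}
    (hC : Convex ℝ C) (hcomp : IsCompact C) (hCne : C.Nonempty)
    (hKne : K.Nonempty) {ρ : ℝ} (h : ¬ ∃ t : V, K ⊆ t +ᵥ ρ • C) :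
    ∃ p1 ∈ K, ∃ p2 ∈ K, ∃ p3 ∈ K, ∃ f : (V × V) →L[ℝ] ℝ, ‖f‖ = 1 ∧
      ∀ x1 ∈ C, ∀ x2 ∈ C, ∀ x3 ∈ C,
        0 ≤ f (p1 - p2 - ρ • (x1 - x2), p1 - p3 - ρ • (x1 - x3)) := by
  classical
  have h3 : ∃ p1 ∈ K, ∃ p2 ∈ K, ∃ p3 ∈ K, ∀ x1 ∈ C, ∀ x2 ∈ C, ∀ x3 ∈ C,
      ¬ (p1 - ρ • x1 = p2 - ρ • x2 ∧ p1 - ρ • x1 = p3 - ρ • x3) := by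
    by_contra! hcon
    apply h
    have := Convex.helly_theorem_compact' (𝕜 := ℝ) (F := fun p : K => (fun x => (p : V) - ρ • x) '' C)
      (fun p => ?_) (fun p => ?_) (fun I hI => ?_)
    · obtain ⟨t, ht⟩ := this
      refine ⟨t, fun p hp => ?_⟩
      rw [mem_iInter] at ht
      obtain ⟨x, hx, hxt⟩ := ht ⟨p, hp⟩
      rw [vs_mem]
      exact ⟨x, hx, by rw [← hxt]; simp⟩
    · have : (fun x => (p : V) - ρ • x) '' C = {(p : V)} + (-ρ) • C := by
        ext y
        constructor
        · rintro ⟨x, hx, rfl⟩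
          exact ⟨_, rfl, _, ⟨x, hx, rfl⟩, by simp [sub_eq_add_neg]⟩
        · rintro ⟨_, rfl, _, ⟨x, hx, rfl⟩, rfl⟩
          exact ⟨x, hx, by simp [sub_eq_add_neg]⟩
      rw [this]
      exact (convex_singleton _).add (hC.smul _)
    · exact hcomp.image (by fun_prop)
    · rw [hdim] at hI
      obtain ⟨k0, hk0⟩ := hKne
      obtain ⟨a, b, c, habc⟩ := card_three I ⟨k0, hk0⟩ hI
      obtain ⟨x1, hx1, x2, hx2, x3, hx3, e1, e2⟩ := hcon a a.2 b b.2 c c.2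
      refine ⟨a - ρ • x1, ?_⟩
      simp only [mem_iInter]
      intro i hi
      have := habc hi
      simp only [Finset.mem_insert, Finset.mem_singleton] at this
      rcases this with rfl | rfl | rfl
      · exact ⟨x1, hx1, rfl⟩
      · exact ⟨x2, hx2, e1.symm⟩
      · exact ⟨x3, hx3, e2.symm⟩
  obtain ⟨p1, hp1, p2, hp2, p3, hp3, hp⟩ := h3
  refine ⟨p1, hp1, p2, hp2, p3, hp3, ?_⟩
  let L : V × V × V →ₗ[ℝ] V × V :=
    { toFun := fun x => ((-ρ) • (x.1 - x.2.1), (-ρ) • (x.1 - x.2.2))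
      map_add' := by intro x y; ext <;> simp <;> module
      map_smul' := by intro c x; ext <;> simp <;> module }
  have hL : Continuous L := L.continuous_of_finiteDimensional
  set A : Set (V × V) := {(p1 - p2, p1 - p3)} + L '' (C ×ˢ C ×ˢ C) with hA
  have hAconv : Convex ℝ A :=
    (convex_singleton _).add ((hC.prod (hC.prod hC)).linear_image L)
  have hAcomp : IsCompact A :=
    isCompact_singleton.add ((hcomp.prod (hcomp.prod hcomp)).image hL)
  have hmem : ∀ x1 ∈ C, ∀ x2 ∈ C, ∀ x3 ∈ C,
      (p1 - p2 - ρ • (x1 - x2), p1 - p3 - ρ • (x1 - x3)) ∈ A := by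
    intro x1 hx1 x2 hx2 x3 hx3
    refine ⟨_, rfl, _, ⟨(x1, x2, x3), ⟨hx1, hx2, hx3⟩, rfl⟩, ?_⟩
    ext <;> simp only [L, LinearMap.coe_mk, AddHom.coe_mk, Prod.mk_add_mk] <;> module
  have h0 : (0 : V × V) ∉ A := by
    rintro ⟨_, rfl, _, ⟨⟨x1, x2, x3⟩, ⟨hx1, hx2, hx3⟩, rfl⟩, e⟩
    apply hp x1 hx1 x2 hx2 x3 hx3
    have e1 := congrArg Prod.fst e
    have e2 := congrArg Prod.snd e
    simp only [L, LinearMap.coe_mk, AddHom.coe_mk, Prod.mk_add_mk, Prod.fst_zero, Prod.snd_zero] at e1 e2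
    constructor
    · rw [← sub_eq_zero, ← e1]; module
    · rw [← sub_eq_zero, ← e2]; module
  obtain ⟨f, u, hu, hf⟩ := geometric_hahn_banach_point_closed hAconv hAcomp.isClosed h0
  rw [map_zero] at hu
  have hf0 : f ≠ 0 := by
    rintro rfl
    obtain ⟨x, hx⟩ := hCne
    have := hf _ (hmem x hx x hx x hx)
    simp at this
    linarith
  have hn : 0 < ‖f‖ := norm_pos_iff.2 hf0
  refine ⟨‖f‖⁻¹ • f, ?_, fun x1 hx1 x2 hx2 x3 hx3 => ?_⟩
  · rw [norm_smul, norm_inv, norm_norm, inv_mul_cancel₀ hn.ne']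
  · have := hf _ (hmem x1 hx1 x2 hx2 x3 hx3)
    rw [smul_apply, smul_eq_mul]
    exact mul_nonneg (by positivity) (by linarith)

lemma helly_opt [FiniteDimensional ℝ V] (hdim : Module.finrank ℝ V = 2) {K C : Set V}
    (hC : Convex ℝ C) (hcomp : IsCompact C) (hCne : C.Nonempty)
    (hK : IsCompact K) (hKne : K.Nonempty) (hR : 0 < circumradius K C) :
    ∃ p1 ∈ K, ∃ p2 ∈ K, ∃ p3 ∈ K, ∃ f : (V × V) →L[ℝ] ℝ, ‖f‖ = 1 ∧
      ∀ x1 ∈ C, ∀ x2 ∈ C, ∀ x3 ∈ C,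
        0 ≤ f (p1 - p2 - circumradius K C • (x1 - x2), p1 - p3 - circumradius K C • (x1 - x3)) := by
  set R := circumradius K C with hRdef
  let E : Set (ℝ × (V × V × V) × ((V × V) →L[ℝ] ℝ)) :=
    (Icc 0 R ×ˢ (K ×ˢ K ×ˢ K) ×ˢ Metric.sphere 0 1) ∩
      {z | ∀ x1 ∈ C, ∀ x2 ∈ C, ∀ x3 ∈ C,
        0 ≤ z.2.2 (z.2.1.1 - z.2.1.2.1 - z.1 • (x1 - x2), z.2.1.1 - z.2.1.2.2 - z.1 • (x1 - x3))}
  have hE : IsCompact E := by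
    have : ProperSpace ((V × V) →L[ℝ] ℝ) := FiniteDimensional.proper_real _
    refine (isCompact_Icc.prod ((hK.prod (hK.prod hK)).prod (isCompact_sphere 0 1))).inter_right ?_
    simp only [ofPred_forall]
    refine isClosed_iInter fun x1 => isClosed_iInter fun _ => isClosed_iInter fun x2 =>
      isClosed_iInter fun _ => isClosed_iInter fun x3 => isClosed_iInter fun _ => ?_
    exact isClosed_le continuous_const (by fun_prop)
  have hcl : IsClosed (Prod.fst '' E) := (hE.image continuous_fst).isClosed
  have hsub : Ioo 0 R ⊆ Prod.fst '' E := by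
    intro ρ hρ
    have : ¬ ∃ t : V, K ⊆ t +ᵥ ρ • C := by
      intro ht
      have := csInf_le (circ_bdd K C) ⟨hρ.1.le, ht⟩
      exact absurd hρ.2 (not_lt.2 this)
    obtain ⟨p1, hp1, p2, hp2, p3, hp3, f, hf, hh⟩ := helly_sep hdim hC hcomp hCne hKne this
    exact ⟨(ρ, (p1, p2, p3), f), ⟨⟨⟨hρ.1.le, hρ.2.le⟩, ⟨hp1, hp2, hp3⟩, by simpa using hf⟩, hh⟩, rfl⟩
  have hRcl : R ∈ closure (Ioo 0 R) := by
    rw [closure_Ioo hR.ne]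
    exact ⟨hR.le, le_refl _⟩
  obtain ⟨⟨ρ, ⟨p1, p2, p3⟩, f⟩, ⟨⟨_, ⟨hp1, hp2, hp3⟩, hf⟩, hh⟩, hρ⟩ := (closure_minimal hsub hcl) hRcl
  simp only at hρ
  subst hρ
  exact ⟨p1, hp1, p2, hp2, p3, hp3, f, by simpa using hf, hh⟩

/-- Optimality: three functionals summing to zero. -/
lemma helly_fun [FiniteDimensional ℝ V] (hdim : Module.finrank ℝ V = 2) {K C : Set V}
    (hC : Convex ℝ C) (hcomp : IsCompact C) (hfd : (interior C).Nonempty)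
    (hK : IsCompact K) (hKne : K.Nonempty) (hR : 0 < circumradius K C) :
    ∃ p1 ∈ K, ∃ p2 ∈ K, ∃ p3 ∈ K, ∃ f1 f2 f3 : V →L[ℝ] ℝ, ∃ c1 c2 c3 : ℝ,
      (∀ x, f1 x + f2 x + f3 x = 0) ∧ (∀ x ∈ C, f1 x ≤ c1) ∧ (∀ x ∈ C, f2 x ≤ c2) ∧
      (∀ x ∈ C, f3 x ≤ c3) ∧ 0 < c1 + c2 + c3 ∧
      circumradius K C * (c1 + c2 + c3) ≤ f1 p1 + f2 p2 + f3 p3 := by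
  have hCne : C.Nonempty := hfd.mono interior_subset
  obtain ⟨p1, hp1, p2, hp2, p3, hp3, f, hf, hh⟩ := helly_opt hdim hC hcomp hCne hK hKne hR
  set R := circumradius K C
  let g := f.comp (ContinuousLinearMap.inl ℝ V V)
  let k := f.comp (ContinuousLinearMap.inr ℝ V V)
  have hgk : ∀ x y, f (x, y) = g x + k y := by
    intro x y
    simp only [g, k, ContinuousLinearMap.comp_apply, ContinuousLinearMap.inl_apply,
      ContinuousLinearMap.inr_apply, ← map_add]
    simp
  obtain ⟨x1, hx1, m1⟩ := hcomp.exists_isMaxOn hCne (g + k).continuous.continuousOn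
  obtain ⟨x2, hx2, m2⟩ := hcomp.exists_isMaxOn hCne (-g).continuous.continuousOn
  obtain ⟨x3, hx3, m3⟩ := hcomp.exists_isMaxOn hCne (-k).continuous.continuousOn
  refine ⟨p1, hp1, p2, hp2, p3, hp3, g + k, -g, -k, (g + k) x1, (-g) x2, (-k) x3,
    fun x => by simp, fun x hx => m1 hx, fun x hx => m2 hx, fun x hx => m3 hx, ?_, ?_⟩
  · obtain ⟨c, hc⟩ := hfd
    have hcC := interior_subset hc
    have lem : ∀ a : V →L[ℝ] ℝ, a ≠ 0 → ∃ y ∈ C, a c < a y := by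
      intro a ha
      obtain ⟨v, hv⟩ : ∃ v, 0 < a v := by
        obtain ⟨v, hv⟩ := DFunLike.ne_iff.1 ha
        rcases lt_or_gt_of_ne hv with h | h
        · exact ⟨-v, by simpa using h⟩
        · exact ⟨v, h⟩
      have hcont : Continuous (fun s : ℝ => c + s • v) := by fun_prop
      have hn : (fun s : ℝ => c + s • v) ⁻¹' (interior C) ∈ nhds (0 : ℝ) :=
        hcont.continuousAt.preimage_mem_nhds (by simpa using isOpen_interior.mem_nhds hc)
      obtain ⟨ε, hε, hb⟩ := Metric.mem_nhds_iff.1 hn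
      have : ε / 2 ∈ Metric.ball (0 : ℝ) ε := by
        rw [Metric.mem_ball, Real.dist_eq, sub_zero, abs_of_pos (by linarith)]; linarith
      refine ⟨_, interior_subset (hb this), ?_⟩
      simp only [map_add, map_smul, smul_eq_mul]
      have : 0 < ε / 2 * a v := by positivity
      linarith
    have i1 : (g + k) c ≤ (g + k) x1 := m1 hcC
    have i2 : (-g) c ≤ (-g) x2 := m2 hcC
    have i3 : (-k) c ≤ (-k) x3 := m3 hcC
    have hs : (g + k) c + (-g) c + (-k) c = 0 := by simp
    have hne : -g ≠ 0 ∨ -k ≠ 0 := by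
      by_contra! hcon
      have hg : g = 0 := neg_eq_zero.1 hcon.1
      have hk : k = 0 := neg_eq_zero.1 hcon.2
      have : f = 0 := by
        ext x <;> simp [hgk, hg, hk]
      rw [this] at hf
      simp at hf
    rcases hne with h | h
    · obtain ⟨y, hy, hlt⟩ := lem _ h
      have : (-g) y ≤ (-g) x2 := m2 hy
      linarith
    · obtain ⟨y, hy, hlt⟩ := lem _ h
      have : (-k) y ≤ (-k) x3 := m3 hy
      linarith
  · have := hh x1 hx1 x2 hx2 x3 hx3
    rw [hgk] at this
    simp only [map_sub, map_smul, smul_eq_mul] at this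
    simp only [add_apply, neg_apply]
    linarith

lemma dual_bound {C : Set V} (hC : Convex ℝ C) (hne : C.Nonempty) {D B : ℝ} (hD : 0 ≤ D)
    (g : V →L[ℝ] ℝ) (h1 : ∀ x ∈ C, g x ≤ B) (h2 : ∀ x ∈ C, -g x ≤ B) {p q m : V}
    (hm : m ∈ symMAX C) (h : p - q = D • m) : g p - g q ≤ D * B := by
  obtain ⟨x, hx, y, hy, a, b, ha, hb, hab, rfl⟩ := (symMAX_mem hC hne).1 hm
  rw [← map_sub, h]
  simp only [map_sub, map_smul, smul_eq_mul]
  apply mul_le_mul_of_nonneg_left _ hD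
  have e1 := mul_le_mul_of_nonneg_left (h1 x hx) ha
  have e2 := mul_le_mul_of_nonneg_left (h2 y hy) hb
  have : a * B + b * B = B := by rw [← add_mul, hab, one_mul]
  linarith

lemma triangle_of [FiniteDimensional ℝ V] (hdim : Module.finrank ℝ V = 2) {C : Set V}
    (hC : Convex ℝ C) (h0 : (0 : V) ∈ C) {x y : V} (hx : x ∈ C) (hy : y ∈ C)
    (f2 f3 : V →L[ℝ] ℝ) {c : ℝ} (hc : 0 < c) (h2 : ∀ z ∈ C, f2 z ≤ 0) (h3 : ∀ z ∈ C, f3 z ≤ 0)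
    (h1 : ∀ z ∈ C, -f2 z - f3 z ≤ c) (x2 : f2 x = 0) (x3 : f3 x = -c) (y2 : f2 y = -c)
    (y3 : f3 y = 0) : C = convexHull ℝ {0, x, y} := by
  apply Subset.antisymm
  · intro z hz
    have hli : LinearIndependent ℝ ![x, y] := by
      rw [LinearIndependent.pair_iff]
      intro s t hst
      have e2 := congrArg f2 hst
      have e3 := congrArg f3 hst
      simp only [map_add, map_smul, x2, x3, y2, y3, smul_eq_mul, map_zero] at e2 e3
      constructor
      · have : s * c = 0 := by linarith
        simpa [hc.ne'] using this
      · have : t * c = 0 := by linarith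
        simpa [hc.ne'] using this
    have hspan := hli.span_eq_top_of_card_eq_finrank (by simp [hdim])
    have hz' : z ∈ Submodule.span ℝ ({x, y} : Set V) := by
      have : Set.range ![x, y] = {x, y} := by simp [Matrix.range_cons, Set.pair_comm]
      rw [← this, hspan]; trivial
    obtain ⟨s, t, rfl⟩ := Submodule.mem_span_pair.1 hz'
    have e1 := h1 _ hz
    have e2 := h2 _ hz
    have e3 := h3 _ hz
    simp only [map_add, map_smul, x2, x3, y2, y3, smul_eq_mul] at e1 e2 e3
    have hs : 0 ≤ s := by by_contra! hn; nlinarith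
    have ht : 0 ≤ t := by by_contra! hn; nlinarith
    have hst : s + t ≤ 1 := by by_contra! hn; nlinarith
    have hconv := convex_convexHull ℝ ({0, x, y} : Set V)
    have m0 : (0 : V) ∈ convexHull ℝ ({0, x, y} : Set V) := subset_convexHull ℝ _ (by simp)
    have mx : x ∈ convexHull ℝ ({0, x, y} : Set V) := subset_convexHull ℝ _ (by simp)
    have my : y ∈ convexHull ℝ ({0, x, y} : Set V) := subset_convexHull ℝ _ (by simp)
    have := hconv.sum_mem (t := Finset.univ) (w := ![1 - s - t, s, t]) (z := ![0, x, y])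
      (by intro i _; fin_cases i <;> simp <;> linarith) (by simp only [Fin.sum_univ_three]; simp; ring)
      (by intro i _; fin_cases i <;> simpa)
    simpa [Fin.sum_univ_three] using this
  · refine convexHull_min ?_ hC
    rintro z (rfl | rfl | rfl) <;> assumption

lemma core [FiniteDimensional ℝ V] (hdim : Module.finrank ℝ V = 2) {C : Set V}
    (hC : Convex ℝ C) (h0 : (0 : V) ∈ C) {R D : ℝ} (hD : 0 ≤ D) {p1 p2 p3 : V}
    (h12 : ∃ m ∈ symMAX C, p1 - p2 = D • m) (h13 : ∃ m ∈ symMAX C, p1 - p3 = D • m)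
    (h23 : ∃ m ∈ symMAX C, p2 - p3 = D • m) (f1 f2 f3 : V →L[ℝ] ℝ) {c1 c2 c3 : ℝ}
    (hsum : ∀ x, f1 x + f2 x + f3 x = 0) (hf1 : ∀ x ∈ C, f1 x ≤ c1) (hf2 : ∀ x ∈ C, f2 x ≤ c2)
    (hf3 : ∀ x ∈ C, f3 x ≤ c3) (hc : 0 < c1 + c2 + c3)
    (hopt : R * (c1 + c2 + c3) ≤ f1 p1 + f2 p2 + f3 p3) (hc2 : c2 ≤ c1) (hc3 : c3 ≤ c1) :
    2 * R ≤ 3 * D ∧ (2 * R = 3 * D → 0 < D → ∃ u v, C = convexHull ℝ {0, u, v}) := by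
  have hne : C.Nonempty := ⟨0, h0⟩
  have p2n : 0 ≤ c2 := by simpa using hf2 0 h0
  have p3n : 0 ≤ c3 := by simpa using hf3 0 h0
  obtain ⟨m12, hm12, e12⟩ := h12
  obtain ⟨m13, hm13, e13⟩ := h13
  obtain ⟨m23, hm23, e23⟩ := h23
  set B := max c1 (c2 + c3) with hB
  have b1 : ∀ x ∈ C, f1 x ≤ B := fun x hx => (hf1 x hx).trans (le_max_left _ _)
  have b1' : ∀ x ∈ C, -f1 x ≤ B := fun x hx => by
    have := le_max_right c1 (c2 + c3)
    linarith [hsum x, hf2 x hx, hf3 x hx]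
  set B' := c1 + 2 * max c2 c3 with hB'
  have b2 : ∀ x ∈ C, (f2 - f3) x ≤ B' := fun x hx => by
    have := le_max_left c2 c3
    simp only [sub_apply]
    linarith [hsum x, hf2 x hx, hf1 x hx]
  have b2' : ∀ x ∈ C, -(f2 - f3) x ≤ B' := fun x hx => by
    have := le_max_right c2 c3
    simp only [sub_apply]
    linarith [hsum x, hf3 x hx, hf1 x hx]
  have k1 := dual_bound hC hne hD f1 b1 b1' hm12 e12
  have k2 := dual_bound hC hne hD f1 b1 b1' hm13 e13
  have k3 := dual_bound hC hne hD (f2 - f3) b2 b2' hm23 e23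
  simp only [sub_apply] at k3
  have hs1 := hsum p1
  have hs2 := hsum p2
  have hs3 := hsum p3
  have hk : 2 * R * (c1 + c2 + c3) ≤ D * (2 * B + B') := by linarith
  have hBB : 2 * B + B' ≤ 3 * (c1 + c2 + c3) := by
    rw [hB, hB']
    rcases max_cases c1 (c2 + c3) with h | h <;> rcases max_cases c2 c3 with h' | h' <;> linarith
  have hk2 : D * (2 * B + B') ≤ D * (3 * (c1 + c2 + c3)) := mul_le_mul_of_nonneg_left hBB hD
  refine ⟨?_, ?_⟩
  · by_contra! hlt
    nlinarith
  · intro heq hDpos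
    have heq' : D * (3 * (c1 + c2 + c3)) = 2 * R * (c1 + c2 + c3) := by rw [heq]; ring
    have hBB2 : 2 * B + B' = 3 * (c1 + c2 + c3) := by
      have : D * (2 * B + B') = D * (3 * (c1 + c2 + c3)) := by linarith
      exact mul_left_cancel₀ hDpos.ne' this
    have hz : c2 = 0 ∧ c3 = 0 := by
      rw [hB, hB'] at hBB2
      rcases max_cases c1 (c2 + c3) with h | h <;> rcases max_cases c2 c3 with h' | h' <;>
        constructor <;> linarith
    obtain ⟨rfl, rfl⟩ := hz
    have hBc : B = c1 := by rw [hB]; apply max_eq_left; linarith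
    have hBc' : B' = c1 := by rw [hB']; simp
    rw [hBc] at k1 k2
    rw [hBc'] at k3
    have q3 : (f2 p2 - f3 p2) - (f2 p3 - f3 p3) = D * c1 := by
      rw [hBc, hBc'] at hk; nlinarith
    have q1 : f1 p2 - f1 p3 = 0 := by
      rw [hBc, hBc'] at hk; nlinarith
    obtain ⟨x, hx, y, hy, a, b, ha, hb, hab, rfl⟩ := (symMAX_mem hC hne).1 hm23
    have r2 := congrArg f2 e23
    have r3 := congrArg f3 e23
    have r1 := congrArg f1 e23
    simp only [map_sub, map_smul, smul_eq_mul] at r1 r2 r3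
    have s1 : a * f1 x = b * f1 y := by
      have : D * (a * f1 x - b * f1 y) = 0 := by linarith
      rcases mul_eq_zero.1 this with h | h
      · exact absurd h hDpos.ne'
      · linarith
    have s2 : (a * f2 x - b * f2 y) - (a * f3 x - b * f3 y) = c1 := by
      apply mul_left_cancel₀ hDpos.ne'
      linarith
    have hc1 : 0 < c1 := by linarith
    have x1 := hf1 x hx
    have x2 := hf2 x hx
    have x3 := hf3 x hx
    have y1 := hf1 y hy
    have y2 := hf2 y hy
    have y3 := hf3 y hy
    have sx := hsum x
    have sy := hsum y
    -- reduce to a = b = 1/2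
    have tx : f2 x - f3 x = f1 x + 2 * f2 x := by linarith
    have ty : f3 y - f2 y = f1 y + 2 * f3 y := by linarith
    have s3 : a * f1 x + 2 * (a * f2 x) + (b * f1 y + 2 * (b * f3 y)) = c1 := by
      have e1 : a * (f2 x - f3 x) = a * (f1 x + 2 * f2 x) := by rw [tx]
      have e2 : b * (f3 y - f2 y) = b * (f1 y + 2 * f3 y) := by rw [ty]
      linarith
    have n1 : a * f2 x ≤ 0 := mul_nonpos_of_nonneg_of_nonpos ha x2
    have n2 : b * f3 y ≤ 0 := mul_nonpos_of_nonneg_of_nonpos hb y3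
    have n3 : a * f1 x ≤ a * c1 := mul_le_mul_of_nonneg_left x1 ha
    have n4 : b * f1 y ≤ b * c1 := mul_le_mul_of_nonneg_left y1 hb
    have n5 : a * c1 + b * c1 = c1 := by rw [← add_mul, hab, one_mul]
    have ha2 : a = 1 / 2 := by
      have : a * c1 = 1 / 2 * c1 := by linarith
      exact mul_right_cancel₀ hc1.ne' this
    have hb2 : b = 1 / 2 := by linarith
    subst ha2 hb2
    exact ⟨x, y, triangle_of hdim hC h0 hx hy f2 f3 hc1 hf2 hf3
      (fun z hz => by linarith [hf1 z hz, hsum z]) (by linarith) (by linarith) (by linarith)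
      (by linarith)⟩

lemma part_one [FiniteDimensional ℝ V] (hdim : Module.finrank ℝ V = 2) {K C : Set V}
    (hC : Convex ℝ C) (hcomp : IsCompact C) (h0 : (0 : V) ∈ C) (hfd : (interior C).Nonempty)
    (hK : IsCompact K) (hKne : K.Nonempty) :
    2 * circumradius K C ≤ 3 * DMAX K C ∧ (2 * circumradius K C = 3 * DMAX K C → 0 < DMAX K C →
      ∃ u v, C = convexHull ℝ {0, u, v}) := by
  have hD : 0 ≤ DMAX K C := by
    have := circ_nonneg (symAM K) (symMAX C)
    rw [DMAX]; linarith
  rcases (circ_nonneg K C).eq_or_lt with hR | hR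
  · exact ⟨by linarith, fun _ _ => by linarith⟩
  obtain ⟨p1, hp1, p2, hp2, p3, hp3, f1, f2, f3, c1, c2, c3, hs, hf1, hf2, hf3, hc, hopt⟩ :=
    helly_fun hdim hC hcomp hfd hK hKne hR
  have dm : ∀ {p q : V}, p ∈ K → q ∈ K → ∃ m ∈ symMAX C, p - q = DMAX K C • m :=
    fun hp hq => DMAX_mem hC hcomp h0 hfd hK hp hq
  by_cases h1 : c2 ≤ c1 ∧ c3 ≤ c1
  · exact core hdim hC h0 hD (dm hp1 hp2) (dm hp1 hp3) (dm hp2 hp3) f1 f2 f3 hs hf1 hf2 hf3 hc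
      hopt h1.1 h1.2
  by_cases h2 : c1 ≤ c2 ∧ c3 ≤ c2
  · exact core hdim hC h0 hD (dm hp2 hp1) (dm hp2 hp3) (dm hp1 hp3) f2 f1 f3
      (fun x => by linarith [hs x]) hf2 hf1 hf3 (by linarith)
      (by rw [add_comm c2 c1]; linarith) h2.1 h2.2
  · have h3 : c2 ≤ c3 ∧ c1 ≤ c3 := by
      by_contra h3
      rw [not_and_or] at h1 h2 h3
      rcases h1 with h1 | h1 <;> rcases h2 with h2 | h2 <;> rcases h3 with h3 | h3 <;> linarith
    exact core hdim hC h0 hD (dm hp3 hp2) (dm hp3 hp1) (dm hp2 hp1) f3 f2 f1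
      (fun x => by linarith [hs x]) hf3 hf2 hf1 (by linarith)
      (by rw [show c3 + c2 + c1 = c1 + c2 + c3 by ring]; linarith) h3.1 h3.2

lemma part_two [FiniteDimensional ℝ V] (hdim : Module.finrank ℝ V = 2) {C : Set V}
    (hC : Convex ℝ C) (hcomp : IsCompact C) (h0 : (0 : V) ∈ C) (hfd : (interior C).Nonempty)
    {u v : V} (hCuv : C = convexHull ℝ {0, u, v}) :
    ∃ K : Set V, Convex ℝ K ∧ IsCompact K ∧ K.Nonempty ∧ (¬ ∃ p : V, K = {p}) ∧
      DMAX K C = 2 / 3 * circumradius K C := by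
  have hspan : Submodule.span ℝ ({u, v} : Set V) = ⊤ := by
    apply Submodule.eq_top_of_nonempty_interior'
    refine hfd.mono (interior_mono ?_)
    rw [hCuv]
    refine convexHull_min ?_ (Submodule.convex _)
    rintro z (rfl | rfl | rfl)
    · exact Submodule.zero_mem _
    · exact Submodule.subset_span (by simp)
    · exact Submodule.subset_span (by simp)
  have hrange : Set.range ![u, v] = {u, v} := by simp [Matrix.range_cons, Set.pair_comm]
  have hli : LinearIndependent ℝ ![u, v] := by
    apply linearIndependent_of_top_le_span_of_card_eq_finrank
    · rw [hrange, hspan]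
    · simp [hdim]
  let b : Module.Basis (Fin 2) ℝ V := Module.Basis.mk hli (by rw [hrange, hspan])
  have hb0 : b 0 = u := by simp [b]
  have hb1 : b 1 = v := by simp [b]
  have xu : b.coord 0 u = 1 := by rw [← hb0]; simp
  have xv : b.coord 0 v = 0 := by rw [← hb1]; simp
  have yu : b.coord 1 u = 0 := by rw [← hb0]; simp
  have yv : b.coord 1 v = 1 := by rw [← hb1]; simp
  have hu : u ∈ C := by rw [hCuv]; exact subset_convexHull ℝ _ (by simp)
  have hv : v ∈ C := by rw [hCuv]; exact subset_convexHull ℝ _ (by simp)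
  have hbd : ∀ z ∈ C, 0 ≤ b.coord 0 z ∧ 0 ≤ b.coord 1 z ∧ b.coord 0 z + b.coord 1 z ≤ 1 := by
    have hsub : C ⊆ ({z | 0 ≤ b.coord 0 z} ∩ {z | 0 ≤ b.coord 1 z}) ∩
        {z | (b.coord 0 + b.coord 1) z ≤ 1} := by
      rw [hCuv]
      refine convexHull_min ?_ ?_
      · rintro z (rfl | rfl | rfl)
        · simp
        · simp only [mem_inter_iff, mem_ofPred_eq, LinearMap.add_apply, xu, yu]; norm_num
        · simp only [mem_inter_iff, mem_ofPred_eq, LinearMap.add_apply, xv, yv]; norm_num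
      · exact ((convex_halfSpace_ge (b.coord 0).isLinear 0).inter
          (convex_halfSpace_ge (b.coord 1).isLinear 0)).inter
          (convex_halfSpace_le (b.coord 0 + b.coord 1).isLinear 1)
    intro z hz
    obtain ⟨⟨h1, h2⟩, h3⟩ := hsub hz
    exact ⟨h1, h2, h3⟩
  have hMc := symMAX_compact hC hcomp ⟨0, h0⟩
  have hMconv : Convex ℝ (symMAX C) := convex_convexHull ℝ _
  set K : Set V := (2 : ℝ)⁻¹ • symMAX C with hKdef
  have hK : IsCompact K := hMc.smul _
  have hsub : ∀ z ∈ C, (2 : ℝ)⁻¹ • z ∈ K := fun z hz =>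
    ⟨z, subset_convexHull ℝ _ (Or.inl hz), rfl⟩
  have hsub' : ∀ z ∈ C, (2 : ℝ)⁻¹ • (-z) ∈ K := fun z hz =>
    ⟨-z, symMAX_neg (subset_convexHull ℝ _ (Or.inl hz)), rfl⟩
  have hKne : K.Nonempty := ⟨_, hsub 0 h0⟩
  have hDle : DMAX K C ≤ 1 := by
    have : circumradius (symAM K) (symMAX C) ≤ 1 / 2 := by
      refine csInf_le (circ_bdd _ _) ⟨by norm_num, 0, ?_⟩
      rintro _ ⟨_, ⟨_, ⟨m, hm, rfl⟩, _, ⟨n, hn, rfl⟩, rfl⟩, rfl⟩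
      rw [vs_mem]
      refine ⟨(2 : ℝ)⁻¹ • m + (2 : ℝ)⁻¹ • (-n),
        hMconv hm (symMAX_neg hn) (by norm_num) (by norm_num) (by norm_num), ?_⟩
      simp only
      module
    rw [DMAX]; linarith
  have hRge : 3 / 2 ≤ circumradius K C := by
    refine le_csInf (circ_nonempty hK hfd) ?_
    rintro ρ ⟨hρ, t, ht⟩
    obtain ⟨z1, hz1, e1⟩ := vs_mem.1 (ht (hsub' u hu))
    obtain ⟨z2, hz2, e2⟩ := vs_mem.1 (ht (hsub' v hv))
    obtain ⟨z3, hz3, e3⟩ := vs_mem.1 (ht (hsub u hu))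
    have q1 := congrArg (b.coord 0) e1
    have q2 := congrArg (b.coord 1) e2
    have q3 := congrArg (b.coord 0) e3
    have q4 := congrArg (b.coord 1) e3
    simp only [map_add, map_smul, map_neg, xu, yv, yu, smul_eq_mul] at q1 q2 q3 q4
    have g1 := mul_nonneg hρ (hbd z1 hz1).1
    have g2 := mul_nonneg hρ (hbd z2 hz2).2.1
    have g3 := mul_le_mul_of_nonneg_left (hbd z3 hz3).2.2 hρ
    linarith
  have hmain := (part_one hdim hC hcomp h0 hfd hK hKne).1
  refine ⟨K, hMconv.smul _, hK, hKne, ?_, by linarith⟩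
  rintro ⟨p, hp⟩
  have h1 := hsub u hu
  have h2 := hsub 0 h0
  rw [hp, mem_singleton_iff] at h1 h2
  have := congrArg (b.coord 0) (h1.trans h2.symm)
  simp only [map_smul, xu, smul_eq_mul, map_zero] at this
  norm_num at this

/-- For planar gauges `C` with `0 ∈ C`, `D_MAX(K,C) ≥ (2/3) R(K,C)` for all convex bodies
`K`, and equality is attained for some nondegenerate `K` if and only if `C` is a triangle
with one vertex at the origin. -/
theorem jung_DMAX_two_thirds (C : Set (EuclideanSpace ℝ (Fin 2)))
    (hCconv : Convex ℝ C) (hCcomp : IsCompact C) (h0 : (0 : EuclideanSpace ℝ (Fin 2)) ∈ C)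
    (hCfd : (interior C).Nonempty) :
    (∀ K : Set (EuclideanSpace ℝ (Fin 2)), Convex ℝ K → IsCompact K → K.Nonempty →
        2 / 3 * circumradius K C ≤ DMAX K C) ∧
      ((∃ K : Set (EuclideanSpace ℝ (Fin 2)), Convex ℝ K ∧ IsCompact K ∧ K.Nonempty ∧
          (¬ ∃ p : EuclideanSpace ℝ (Fin 2), K = {p}) ∧
          DMAX K C = 2 / 3 * circumradius K C) ↔
        ∃ u v : EuclideanSpace ℝ (Fin 2), C = convexHull ℝ {0, u, v}) := by
  have hdim : Module.finrank ℝ (EuclideanSpace ℝ (Fin 2)) = 2 := by simp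
  refine ⟨fun K _ hK hKne => ?_, ?_, ?_⟩
  · have := (part_one hdim hCconv hCcomp h0 hCfd hK hKne).1
    linarith
  · rintro ⟨K, _, hK, hKne, hsing, heq⟩
    refine (part_one hdim hCconv hCcomp h0 hCfd hK hKne).2 (by linarith) ?_
    have hD : 0 ≤ DMAX K C := by
      have := circ_nonneg (symAM K) (symMAX C)
      rw [DMAX]; linarith
    rcases hD.eq_or_lt with hD0 | hD0
    · exfalso
      apply hsing
      obtain ⟨p, hp⟩ := hKne
      refine ⟨p, Subset.antisymm (fun q hq => ?_) (by simpa using hp)⟩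
      obtain ⟨m, -, hm⟩ := DMAX_mem hCconv hCcomp h0 hCfd hK hq hp
      rw [← hD0, zero_smul, sub_eq_zero] at hm
      exact hm
    · exact hD0
  · rintro ⟨u, v, huv⟩
    exact part_two hdim hCconv hCcomp h0 hCfd huv
end

section
/- Let K be a nondegenerate convex body in the plane and T a Minkowski-centered equilateral triangle. Then (D_MAX(K,T)/R(K,T) − 1/2)·(3/2 − D_MAX(K,T)/R(K,T)) ≤ r(K,T)/R(K,T). -/
open Pointwise Set

variable {V : Type*} [NormedAddCommGroup V] [NormedSpace ℝ V]

lemma circ_le {K C : Set V} {ρ : ℝ} (h0 : 0 ≤ ρ) (t : V) (h : K ⊆ t +ᵥ ρ • C) :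
    circumradius K C ≤ ρ :=
  csInf_le ⟨0, fun _ h => h.1⟩ ⟨h0, t, h⟩

lemma mem_hom {C : Set V} {ρ : ℝ} {t x : V} : x ∈ t +ᵥ ρ • C ↔ ∃ y ∈ C, x = t + ρ • y := by
  constructor
  · rintro ⟨_, ⟨y, hy, rfl⟩, rfl⟩
    exact ⟨y, hy, rfl⟩
  · rintro ⟨y, hy, rfl⟩
    exact ⟨_, ⟨y, hy, rfl⟩, rfl⟩

abbrev E2 := EuclideanSpace ℝ (Fin 2)

lemma coords (T : Set E2)
    (hT : ∃ p1 p2 p3 : E2,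
      T = convexHull ℝ {p1, p2, p3} ∧ AffineIndependent ℝ ![p1, p2, p3] ∧
        dist p1 p2 = dist p2 p3 ∧ dist p2 p3 = dist p3 p1)
    (hMC : MinkowskiCentered T) :
    ∃ (l : Fin 3 → (E2 →ₗ[ℝ] ℝ)) (p : Fin 3 → E2),
      (∀ i j, l i (p j) = (if i = j then 1 else 0) - 1/3) ∧
      (∀ x, l 0 x + l 1 x + l 2 x = 0) ∧
      (∀ x, (∀ i, l i x = 0) → x = 0) ∧
      (∀ x, x ∈ T ↔ ∀ i, -(1/3) ≤ l i x) ∧ T = convexHull ℝ (Set.range p) := by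
  obtain ⟨p1, p2, p3, hTe, hind, -, -⟩ := hT
  have htop : affineSpan ℝ (Set.range ![p1, p2, p3]) = ⊤ := by
    rw [hind.affineSpan_eq_top_iff_card_eq_finrank_add_one]
    simp
  let b : AffineBasis (Fin 3) ℝ E2 := ⟨![p1, p2, p3], hind, htop⟩
  have hb : ∀ i, b i = ![p1, p2, p3] i := fun i => rfl
  have hrange : Set.range b = {p1, p2, p3} := by
    change Set.range ![p1, p2, p3] = _
    simp [Matrix.range_cons, Matrix.range_empty]
    ext x; simp; tauto
  have hTr : T = convexHull ℝ (Set.range b) := by rw [hrange, hTe]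
  have hTm : ∀ x, x ∈ T ↔ ∀ i, 0 ≤ b.coord i x := by
    intro x
    rw [hTr, b.convexHull_eq_nonneg_coord]; rfl
  have hdec : ∀ i x, b.coord i x = (b.coord i).linear x + b.coord i 0 := by
    intro i x
    exact congrFun (b.coord i).decomp x
  have hsum : ∀ x, b.coord 0 x + b.coord 1 x + b.coord 2 x = 1 := by
    intro x
    have := b.sum_coord_apply_eq_one x
    rwa [Fin.sum_univ_three] at this
  have hpT : ∀ i, b i ∈ T := fun i => hTr ▸ subset_convexHull ℝ _ ⟨i, rfl⟩
  have hcoord : ∀ i j, b.coord i (b j) = if i = j then 1 else 0 := fun i j => b.coord_apply i j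
  -- `s ≤ 2`
  have hs2 : minkAsym T ≤ 2 := by
    refine circ_le (by norm_num) (b 0 + b 1 + b 2) ?_
    intro x hx
    rw [mem_hom]
    refine ⟨(2:ℝ)⁻¹ • (x - (b 0 + b 1 + b 2)), ?_, ?_⟩
    · rw [Set.mem_neg, hTm]
      intro i
      have hxi := (hTm x).1 hx
      have hx2 := hsum x
      have h0 := hsum 0
      have e : b.coord i (-((2:ℝ)⁻¹ • (x - (b 0 + b 1 + b 2)))) =
        (b.coord i (b 0) + b.coord i (b 1) + b.coord i (b 2) - b.coord i x) / 2 := by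
        rw [hdec i (-_), hdec i (b 0), hdec i (b 1), hdec i (b 2), hdec i x]
        simp only [map_neg, map_smul, map_sub, map_add, smul_eq_mul]
        ring
      rw [e, hcoord, hcoord, hcoord]
      have := hxi 0
      have := hxi 1
      have := hxi 2
      fin_cases i <;> simp <;> linarith
    · rw [smul_smul]; norm_num
  have hs0 : 0 ≤ minkAsym T := circ_nonneg _ _
  have hc : ∀ i, 1 ≤ (minkAsym T + 1) * b.coord i 0 := by
    intro i
    obtain ⟨y, hy, hye⟩ := hMC.1 (hpT i)
    have h1 := (hTm _).1 (Set.mem_neg.1 hy) i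
    have h2 := hcoord i i
    simp only [if_true] at h2
    rw [← hye, hdec] at h2
    rw [hdec] at h1
    simp only [map_neg, map_smul, smul_eq_mul] at h1 h2
    nlinarith
  have h0 := hsum 0
  have hcn : ∀ i, 1/3 ≤ b.coord i 0 := by
    intro i
    have := hc i
    have hp : 0 < b.coord i 0 := by
      by_contra h
      push Not at h
      nlinarith
    nlinarith
  have hc3 : ∀ i, b.coord i 0 = 1/3 := by
    intro i
    have := hcn 0
    have := hcn 1
    have := hcn 2
    fin_cases i <;> simp only [Fin.zero_eta, Fin.mk_one, Fin.reduceFinMk] <;> linarith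
  have hl : ∀ i x, (b.coord i).linear x = b.coord i x - 1/3 := by
    intro i x
    rw [hdec i x, hc3]; ring
  refine ⟨fun i => (b.coord i).linear, b, ?_, ?_, ?_, ?_, hTr⟩
  · intro i j
    rw [hl, hcoord]
  · intro x
    simp only [hl]
    linarith [hsum x]
  · intro x hx
    apply b.ext_elem
    intro i
    rw [hdec, hx, zero_add]
  · intro x
    rw [hTm]
    refine forall_congr' fun i => ?_
    simp only [hl]
    constructor <;> intro h <;> linarith

lemma D_bound (K T : Set E2) (f : E2 →ₗ[ℝ] ℝ) (p : Fin 3 → E2)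
    (hT : T = convexHull ℝ (Set.range p)) (hf : ∀ i, |f (p i)| ≤ 1)
    (hne : {ρ : ℝ | 0 ≤ ρ ∧ ∃ t : E2, symAM K ⊆ t +ᵥ ρ • symMAX T}.Nonempty)
    {x y : E2} (hx : x ∈ K) (hy : y ∈ K) : f x - f y ≤ DMAX K T := by
  have hconv : Convex ℝ {z | |f z| ≤ 1} := by
    have : {z | |f z| ≤ 1} = f ⁻¹' (Set.Icc (-1) 1) := by ext z; simp [abs_le]
    rw [this]
    exact (convex_Icc _ _).linear_preimage f
  have hTs : T ⊆ {z | |f z| ≤ 1} := by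
    rw [hT]
    refine convexHull_min ?_ hconv
    rintro _ ⟨i, rfl⟩
    exact hf i
  have hM : ∀ z ∈ symMAX T, |f z| ≤ 1 := by
    refine convexHull_min (union_subset hTs ?_) hconv
    intro z hz
    have h : |f (-z)| ≤ 1 := hTs hz
    rw [map_neg, abs_neg] at h
    exact h
  have : (f x - f y) / 2 ≤ circumradius (symAM K) (symMAX T) := by
    refine le_csInf hne ?_
    rintro ρ ⟨h0, t, ht⟩
    have m : ∀ u ∈ K, ∀ v ∈ K, |f u / 2 - f v / 2 - f t| ≤ ρ := by
      intro u hu v hv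
      have : (2:ℝ)⁻¹ • (u - v) ∈ symAM K := Set.smul_mem_smul_set (Set.sub_mem_sub hu hv)
      obtain ⟨z, hz, he⟩ := mem_hom.1 (ht this)
      have h1 := congrArg f he
      simp only [map_smul, map_sub, map_add, smul_eq_mul] at h1
      have h2 := hM z hz
      have : f u / 2 - f v / 2 - f t = ρ * f z := by linarith
      rw [this, abs_mul, abs_of_nonneg h0]
      nlinarith
    have h1 := abs_le.1 (m x hx y hy)
    have h2 := abs_le.1 (m y hy x hx)
    linarith [h1.2, h2.1]
  unfold DMAX
  linarith

lemma final_ineq (δ u v w : ℝ) (h1 : 1 + u - v ≤ δ) (h2 : 1 + v - w ≤ δ) (h3 : 1 + w - u ≤ δ) :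
    (δ - 1/2) * (3/2 - δ) ≤ 1 - (u + v + w) + (u * v + v * w + w * u) := by
  nlinarith [mul_nonneg (sub_nonneg.2 h1) (sub_nonneg.2 h2),
    mul_nonneg (sub_nonneg.2 h2) (sub_nonneg.2 h3),
    mul_nonneg (sub_nonneg.2 h3) (sub_nonneg.2 h1), sq_nonneg (u + v + w - 3/2)]

/-- For any nondegenerate planar convex body `K` and any Minkowski-centered equilateral
triangle `T`: `(D_MAX/R - 1/2)(3/2 - D_MAX/R) ≤ r/R`. -/
theorem leftMaxT_inequality (K T : Set (EuclideanSpace ℝ (Fin 2)))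
    (hKconv : Convex ℝ K) (hKcomp : IsCompact K) (hKne : K.Nonempty)
    (hKnd : ¬ ∃ p : EuclideanSpace ℝ (Fin 2), K = {p})
    (hT : ∃ p1 p2 p3 : EuclideanSpace ℝ (Fin 2),
      T = convexHull ℝ {p1, p2, p3} ∧ AffineIndependent ℝ ![p1, p2, p3] ∧
        dist p1 p2 = dist p2 p3 ∧ dist p2 p3 = dist p3 p1)
    (hMC : MinkowskiCentered T) :
    (DMAX K T / circumradius K T - 1/2) * (3/2 - DMAX K T / circumradius K T) ≤
      inradius K T / circumradius K T := by
  obtain ⟨l, p, hlp, hsum, hsep, hTm, hTr⟩ := coords T hT hMC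
  have hR0 : 0 ≤ circumradius K T := circ_nonneg _ _
  have hr0 : 0 ≤ inradius K T := Real.sSup_nonneg (fun _ h => h.1)
  by_cases hne : {ρ : ℝ | 0 ≤ ρ ∧ ∃ t : E2, symAM K ⊆ t +ᵥ ρ • symMAX T}.Nonempty
  swap
  · have : DMAX K T = 0 := by
      unfold DMAX circumradius
      rw [Set.not_nonempty_iff_eq_empty.1 hne, Real.sInf_empty, mul_zero]
    rw [this, zero_div]
    have := div_nonneg hr0 hR0
    linarith
  have hcont : ∀ i, ContinuousOn (l i) K := fun i =>
    (LinearMap.continuous_of_finiteDimensional (l i)).continuousOn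
  have hext : ∀ x y, (∀ i, l i x = l i y) → x = y := by
    intro x y h
    rw [← sub_eq_zero]
    exact hsep _ fun i => by rw [map_sub, h, sub_self]
  choose q hqK hq using fun i => hKcomp.exists_isMinOn hKne (hcont i)
  have hmin : ∀ i, ∀ x ∈ K, l i (q i) ≤ l i x := fun i x hx => hq i hx
  obtain ⟨ρ, hρ⟩ : ∃ ρ, ρ = -(l 0 (q 0) + l 1 (q 1) + l 2 (q 2)) := ⟨_, rfl⟩
  have hρpos : 0 < ρ := by
    by_contra hn
    push Not at hn
    apply hKnd
    refine ⟨q 0, Set.eq_singleton_iff_unique_mem.2 ⟨hqK 0, ?_⟩⟩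
    have key : ∀ x ∈ K, ∀ i, l i x = l i (q i) := by
      intro x hx i
      have := hmin 0 x hx
      have := hmin 1 x hx
      have := hmin 2 x hx
      have := hsum x
      fin_cases i <;> simp only [Fin.zero_eta, Fin.mk_one, Fin.reduceFinMk] <;> linarith
    intro x hx
    exact hext _ _ fun i => by rw [key x hx i, key (q 0) (hqK 0) i]
  have hR : circumradius K T = ρ := by
    apply le_antisymm
    · refine circ_le hρpos.le (∑ j, (l j (q j) + ρ/3) • p j) ?_
      intro x hx
      rw [mem_hom]
      refine ⟨ρ⁻¹ • (x - (∑ j, (l j (q j) + ρ/3) • p j)), ?_, ?_⟩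
      · rw [hTm]
        intro i
        have e : l i (∑ j, (l j (q j) + ρ/3) • p j) = l i (q i) + ρ / 3 := by
          simp only [Fin.sum_univ_three, map_add, map_smul, hlp, smul_eq_mul]
          fin_cases i <;> simp <;> linarith
        rw [map_smul, map_sub, e, smul_eq_mul, inv_mul_eq_div, le_div_iff₀ hρpos]
        linarith [hmin i x hx]
      · rw [smul_smul, mul_inv_cancel₀ hρpos.ne', one_smul]; abel
    · refine le_csInf ?_ ?_
      · refine ⟨ρ, hρpos.le, (∑ j, (l j (q j) + ρ/3) • p j), ?_⟩
        intro x hx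
        rw [mem_hom]
        refine ⟨ρ⁻¹ • (x - (∑ j, (l j (q j) + ρ/3) • p j)), ?_, ?_⟩
        · rw [hTm]
          intro i
          have e : l i (∑ j, (l j (q j) + ρ/3) • p j) = l i (q i) + ρ / 3 := by
            simp only [Fin.sum_univ_three, map_add, map_smul, hlp, smul_eq_mul]
            fin_cases i <;> simp <;> linarith
          rw [map_smul, map_sub, e, smul_eq_mul, inv_mul_eq_div, le_div_iff₀ hρpos]
          linarith [hmin i x hx]
        · rw [smul_smul, mul_inv_cancel₀ hρpos.ne', one_smul]; abel
      · rintro σ ⟨hσ, t, ht⟩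
        have m : ∀ i, l i t - σ / 3 ≤ l i (q i) := by
          intro i
          obtain ⟨y, hy, he⟩ := mem_hom.1 (ht (hqK i))
          have := (hTm y).1 hy i
          rw [he, map_add, map_smul, smul_eq_mul]
          nlinarith
        have := m 0
        have := m 1
        have := m 2
        have := hsum t
        linarith
  -- coordinates of the touching points
  obtain ⟨u, hu⟩ : ∃ u, u = (l 1 (q 0) - l 1 (q 1)) / ρ := ⟨_, rfl⟩
  obtain ⟨v, hv⟩ : ∃ v, v = (l 2 (q 1) - l 2 (q 2)) / ρ := ⟨_, rfl⟩
  obtain ⟨w, hw⟩ : ∃ w, w = (l 0 (q 2) - l 0 (q 0)) / ρ := ⟨_, rfl⟩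
  have hu' : l 1 (q 0) = l 1 (q 1) + u * ρ := by rw [hu, div_mul_cancel₀ _ hρpos.ne']; ring
  have hv' : l 2 (q 1) = l 2 (q 2) + v * ρ := by rw [hv, div_mul_cancel₀ _ hρpos.ne']; ring
  have hw' : l 0 (q 2) = l 0 (q 0) + w * ρ := by rw [hw, div_mul_cancel₀ _ hρpos.ne']; ring
  have s0 := hsum (q 0)
  have s1 := hsum (q 1)
  have s2 := hsum (q 2)
  have hu2 : l 2 (q 0) = l 2 (q 2) + (1 - u) * ρ := by linarith
  have hv2 : l 0 (q 1) = l 0 (q 0) + (1 - v) * ρ := by linarith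
  have hw2 : l 1 (q 2) = l 1 (q 1) + (1 - w) * ρ := by linarith
  have pos : ∀ z y : ℝ, y ≤ y + z * ρ → 0 ≤ z := by
    intro z y h
    by_contra hz
    push Not at hz
    nlinarith
  have u0 : 0 ≤ u := pos u _ (hu' ▸ hmin 1 _ (hqK 0))
  have v0 : 0 ≤ v := pos v _ (hv' ▸ hmin 2 _ (hqK 1))
  have w0 : 0 ≤ w := pos w _ (hw' ▸ hmin 0 _ (hqK 2))
  have u1 : 0 ≤ 1 - u := pos _ _ (hu2 ▸ hmin 2 _ (hqK 0))
  have v1 : 0 ≤ 1 - v := pos _ _ (hv2 ▸ hmin 0 _ (hqK 1))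
  have w1 : 0 ≤ 1 - w := pos _ _ (hw2 ▸ hmin 1 _ (hqK 2))
  have d1 := D_bound K T (l 0 - l 1) p hTr
    (by intro i; fin_cases i <;> simp [hlp] <;> norm_num) hne (hqK 1) (hqK 0)
  have d2 := D_bound K T (l 1 - l 2) p hTr
    (by intro i; fin_cases i <;> simp [hlp] <;> norm_num) hne (hqK 2) (hqK 1)
  have d3 := D_bound K T (l 2 - l 0) p hTr
    (by intro i; fin_cases i <;> simp [hlp] <;> norm_num) hne (hqK 0) (hqK 2)
  simp only [LinearMap.sub_apply] at d1 d2 d3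
  rw [hR]
  refine (final_ineq (DMAX K T / ρ) u v w ?_ ?_ ?_).trans ?_
  · rw [le_div_iff₀ hρpos]; linarith
  · rw [le_div_iff₀ hρpos]; linarith
  · rw [le_div_iff₀ hρpos]; linarith
  rw [le_div_iff₀ hρpos]
  obtain ⟨Δ, hΔ⟩ : ∃ Δ, Δ = 1 - (u + v + w) + (u * v + v * w + w * u) := ⟨_, rfl⟩
  have hΔ0 : 0 ≤ Δ := by
    have e : Δ = u * v * w + (1 - u) * (1 - v) * (1 - w) := by rw [hΔ]; ring
    rw [e]; positivity
  rw [← hΔ]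
  refine le_csSup ?_ ⟨by positivity, (1 - u) • q 1 + u • q 2 - (Δ * ρ) • p 0, ?_⟩
  · obtain ⟨M, hM⟩ := (hKcomp.image_of_continuousOn (hcont 0)).bddAbove
    refine ⟨M - l 0 (q 0), ?_⟩
    rintro σ ⟨hσ, t, ht⟩
    have hp : ∀ i, p i ∈ T := fun i => hTr ▸ subset_convexHull ℝ _ ⟨i, rfl⟩
    have k0 := hM ⟨_, ht (mem_hom.2 ⟨_, hp 0, rfl⟩), rfl⟩
    have k1 := hmin 0 _ (ht (mem_hom.2 ⟨_, hp 1, rfl⟩))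
    simp [hlp] at k0 k1
    linarith
  · have hsub : T ⊆ (fun y => ((1 - u) • q 1 + u • q 2 - (Δ * ρ) • p 0) + (Δ * ρ) • y) ⁻¹' K := by
      rw [hTr]
      refine convexHull_min ?_ ?_
      · rintro _ ⟨i, rfl⟩
        rw [Set.mem_preimage]
        have hpt : (1 - u) • q 1 + u • q 2 - (Δ * ρ) • p 0 + (Δ * ρ) • p i =
            ![(1 - u) • q 1 + u • q 2, v • q 0 + (1 - v) • q 2, (1 - w) • q 0 + w • q 1] i := by
          apply hext
          intro j
          have e0 : l 0 (q 0) = - l 1 (q 1) - l 2 (q 2) - ρ := by linarith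
          fin_cases i <;> fin_cases j <;>
            simp [hlp, hu', hv', hw', hu2, hv2, hw2, hΔ, e0] <;> ring
        rw [hpt]
        fin_cases i
        · exact hKconv (hqK 1) (hqK 2) u1 u0 (by ring)
        · exact hKconv (hqK 0) (hqK 2) v0 v1 (by ring)
        · exact hKconv (hqK 0) (hqK 1) w1 w0 (by ring)
      · intro x hx y hy a b ha hb hab
        have := hKconv hx hy ha hb hab
        rw [Set.mem_preimage]
        convert this using 1
        obtain rfl : b = 1 - a := by linarith
        module
    intro x hx
    obtain ⟨y, hy, rfl⟩ := mem_hom.1 hx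
    exact hsub hy
end

section
/- Let K be a convex body and C a Minkowski-centered full-dimensional convex body in R^n with 0 in its interior. Then (n+1)/(2n) ≤ D_MIN(K,C)/(2R(K,C)). Moreover, for every s_C ∈ [1,n] there is a Minkowski-centered gauge C with s(C) = s_C and a simplex K attaining equality. -/
open Pointwise Set

variable {V : Type*} [NormedAddCommGroup V] [NormedSpace ℝ V]

theorem jd_sum_mem {ι E : Type*} [AddCommGroup E] [Module ℝ E] {D : Set E} (hD : Convex ℝ D)
    (h0 : (0 : E) ∈ D) (I : Finset ι) (z : ι → E) (hz : ∀ i ∈ I, z i ∈ D) (a : ℝ) (ha : 0 ≤ a)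
    (ha1 : a * (I.card : ℝ) ≤ 1) : ∑ i ∈ I, a • z i ∈ D := by
  rcases I.eq_empty_or_nonempty with rfl | hI
  · simpa using h0
  have hc : (0 : ℝ) < I.card := by exact_mod_cast hI.card_pos
  have h1 : ∑ i ∈ I, ((I.card : ℝ)⁻¹) • z i ∈ D := by
    apply hD.sum_mem
    · intro i _; positivity
    · simp [hc.ne']
    · exact hz
  have h2 := hD.smul_mem_of_zero_mem h0 h1 (t := a * I.card) ⟨by positivity, ha1⟩
  rw [Finset.smul_sum] at h2
  convert h2 using 2 with i hi
  rw [smul_smul, mul_assoc, mul_inv_cancel₀ hc.ne', mul_one]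

theorem jd_bohn {n : ℕ} (hn : 2 ≤ n) {K D : Set (EuclideanSpace ℝ (Fin n))}
    (hD : Convex ℝ D) (hDc : IsCompact D) (h0 : (0 : EuclideanSpace ℝ (Fin n)) ∈ D)
    (hs : ∀ x ∈ D, -x ∈ D) (hK : ∀ x ∈ K, ∀ y ∈ K, x - y ∈ D) :
    ∃ t : EuclideanSpace ℝ (Fin n), ∀ x ∈ K, ∃ d ∈ D, x = t + ((n : ℝ) / (n + 1)) • d := by
  classical
  have hn0 : (0 : ℝ) < n := by exact_mod_cast (by omega : 0 < n)
  have hr : (0 : ℝ) < (n : ℝ) / (n + 1) := by positivity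
  set r : ℝ := (n : ℝ) / (n + 1) with hrdef
  have key := Convex.helly_theorem_compact' (𝕜 := ℝ)
    (F := fun k : K => (k : EuclideanSpace ℝ (Fin n)) +ᵥ r • D)
    (fun k => (hD.smul r).vadd _) (fun k => (hDc.smul r).vadd _) ?_
  · obtain ⟨t, ht⟩ := key
    refine ⟨t, fun x hx => ?_⟩
    have := Set.mem_iInter.1 ht ⟨x, hx⟩
    obtain ⟨y, ⟨d, hd, rfl⟩, hy⟩ := this
    refine ⟨-d, hs d hd, ?_⟩
    simp only [vadd_eq_add] at hy
    rw [← hy]; simp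
  · intro I hI
    rw [finrank_euclideanSpace, Fintype.card_fin] at hI
    rcases I.eq_empty_or_nonempty with rfl | hIne
    · simp
    have hc : (0 : ℝ) < I.card := by exact_mod_cast hIne.card_pos
    have hI' : (I.card : ℝ) ≤ n + 1 := by exact_mod_cast hI
    refine ⟨(I.card : ℝ)⁻¹ • ∑ i ∈ I, (i : EuclideanSpace ℝ (Fin n)), ?_⟩
    simp only [Set.mem_iInter]
    intro k hk
    have hmem := jd_sum_mem hD h0 (I.erase k)
      (fun i : K => (i : EuclideanSpace ℝ (Fin n)) - k)
      (fun i _ => hK i i.2 k k.2) (r⁻¹ * (I.card : ℝ)⁻¹) (by positivity) (by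
        rw [Finset.card_erase_of_mem hk, Nat.cast_sub (Finset.card_pos.2 hIne), hrdef]
        rw [inv_div, ← div_eq_mul_inv, div_div, div_mul_eq_mul_div, div_le_one (by positivity)]
        push_cast
        nlinarith)
    refine ⟨_, ⟨_, hmem, rfl⟩, ?_⟩
    rw [Finset.sum_erase _ (by simp)]
    simp only [vadd_eq_add]
    rw [Finset.smul_sum]
    simp only [smul_smul, mul_inv_cancel_left₀ hr.ne']
    rw [← Finset.smul_sum, Finset.sum_sub_distrib, smul_sub, Finset.sum_const,
      ← Nat.cast_smul_eq_nsmul ℝ, smul_smul, inv_mul_cancel₀ hc.ne']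
    simp

theorem jd_bdd {V : Type*} [NormedAddCommGroup V] [NormedSpace ℝ V] (K C : Set V) :
    BddBelow {ρ : ℝ | 0 ≤ ρ ∧ ∃ t : V, K ⊆ t +ᵥ ρ • C} := ⟨0, fun _ h => h.1⟩

theorem jd_circ_le {V : Type*} [NormedAddCommGroup V] [NormedSpace ℝ V] {K C : Set V} {ρ : ℝ}
    (t : V) (h0 : 0 ≤ ρ) (h : K ⊆ t +ᵥ ρ • C) : circumradius K C ≤ ρ :=
  csInf_le (jd_bdd K C) ⟨h0, t, h⟩

theorem jd_circ_eq {V : Type*} [NormedAddCommGroup V] [NormedSpace ℝ V] {K C : Set V} {ρ : ℝ}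
    (h0 : 0 ≤ ρ) (h : K ⊆ ρ • C) (hl : ∀ σ : ℝ, 0 ≤ σ → ∀ t : V, K ⊆ t +ᵥ σ • C → ρ ≤ σ) :
    circumradius K C = ρ := by
  have h' : K ⊆ (0 : V) +ᵥ ρ • C := by simpa using h
  apply le_antisymm (jd_circ_le 0 h0 h')
  exact le_csInf ⟨ρ, h0, 0, h'⟩ (fun σ hσ => by
    obtain ⟨h1, t, h2⟩ := hσ
    exact hl σ h1 t h2)

/-- A bounded set is contained in a multiple of a neighbourhood of the origin. -/
theorem jd_absorb {V : Type*} [NormedAddCommGroup V] [NormedSpace ℝ V] {K C : Set V}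
    (hK : Bornology.IsBounded K) (hC : (0 : V) ∈ interior C) :
    ∃ ρ : ℝ, 0 ≤ ρ ∧ K ⊆ ρ • C := by
  obtain ⟨ε, hε, hb⟩ := Metric.isOpen_iff.1 isOpen_interior 0 hC
  obtain ⟨R, hR0, hR⟩ := hK.exists_pos_norm_lt
  refine ⟨R / ε, by positivity, fun x hx => ?_⟩
  rw [Set.mem_smul_set_iff_inv_smul_mem₀ (by positivity)]
  apply interior_subset
  apply hb
  have hx' := hR x hx
  rw [mem_ball_zero_iff, norm_smul, Real.norm_eq_abs, abs_of_pos (by positivity), inv_div,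
    div_mul_eq_mul_div, div_lt_iff₀ hR0]
  nlinarith

theorem jd_circ_pos {V : Type*} [NormedAddCommGroup V] [NormedSpace ℝ V] {K C : Set V}
    (hK : Bornology.IsBounded K) (hC : (0 : V) ∈ interior C) (hCb : Bornology.IsBounded C)
    {x y : V} (hx : x ∈ K) (hy : y ∈ K) (hxy : x ≠ y) : 0 < circumradius K C := by
  obtain ⟨ρ, h0, h⟩ := jd_absorb hK hC
  obtain ⟨R, hR0, hR⟩ := hCb.exists_pos_norm_lt
  have hd : 0 < ‖x - y‖ := norm_pos_iff.2 (sub_ne_zero.2 hxy)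
  refine lt_of_lt_of_le (b := ‖x - y‖ / (2 * R)) (by positivity) ?_
  refine le_csInf ⟨ρ, h0, 0, by simpa using h⟩ ?_
  rintro σ ⟨hσ, t, ht⟩
  obtain ⟨_, ⟨c, hc, rfl⟩, hcx⟩ := ht hx
  obtain ⟨_, ⟨d, hd, rfl⟩, hdy⟩ := ht hy
  rw [div_le_iff₀ (by positivity), ← hcx, ← hdy]
  simp only [vadd_eq_add, add_sub_add_left_eq_sub]
  rw [← smul_sub, norm_smul, Real.norm_eq_abs, abs_of_nonneg hσ]
  have := norm_sub_le c d
  have := hR c hc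
  have := hR d hd
  exact mul_le_mul_of_nonneg_left (by linarith) hσ

theorem jd_part1 {n : ℕ} (hn : 2 ≤ n) (K C : Set (EuclideanSpace ℝ (Fin n)))
    (hKc : IsCompact K) (hKne : K.Nonempty)
    (hK1 : ¬ ∃ p : EuclideanSpace ℝ (Fin n), K = {p})
    (hC : Convex ℝ C) (hCc : IsCompact C) (hC0 : 0 ∈ interior C) :
    ((n : ℝ) + 1) / (2 * (n : ℝ)) ≤ DMIN K C / (2 * circumradius K C) := by
  have hn0 : (0 : ℝ) < n := by exact_mod_cast (by omega : 0 < n)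
  obtain ⟨x, hx⟩ := hKne
  obtain ⟨y, hy, hxy⟩ : ∃ y ∈ K, x ≠ y := by
    by_contra! h
    exact hK1 ⟨x, Set.eq_singleton_iff_unique_mem.2 ⟨hx, fun y hy => (h y hy).symm⟩⟩
  have hpos := jd_circ_pos hKc.isBounded hC0 hCc.isBounded hx hy hxy
  unfold DMIN
  rw [mul_div_mul_left _ _ two_ne_zero, le_div_iff₀ hpos]
  have hB : Convex ℝ (symMIN C) := hC.inter hC.neg
  have hBc : IsCompact (symMIN C) := hCc.inter hCc.neg
  have hB0 : 0 ∈ interior (symMIN C) := by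
    unfold symMIN
    rw [interior_inter]
    refine ⟨hC0, ?_⟩
    rw [mem_interior_iff_mem_nhds] at hC0 ⊢
    have : Filter.Tendsto (fun z : EuclideanSpace ℝ (Fin n) => -z) (nhds 0) (nhds 0) := by
      simpa using (continuous_neg (G := EuclideanSpace ℝ (Fin n))).tendsto 0
    exact this hC0
  have hBs : ∀ z ∈ symMIN C, -z ∈ symMIN C := by
    rintro z ⟨h1, h2⟩
    exact ⟨h2, by simpa using h1⟩
  have hAb : Bornology.IsBounded (symAM K) := by
    have : IsCompact (symAM K) := by
      unfold symAM
      rw [sub_eq_add_neg]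
      exact (hKc.add hKc.neg).smul _
    exact this.isBounded
  obtain ⟨ρ0, h00, h01⟩ := jd_absorb hAb hB0
  refine le_csInf ⟨ρ0, h00, 0, by simpa using h01⟩ ?_
  rintro ρ ⟨hρ, t, ht⟩
  have hdiff : ∀ a ∈ K, ∀ b ∈ K, a - b ∈ (2 * ρ) • symMIN C := by
    intro a ha b hb
    obtain ⟨_, ⟨c, hc, rfl⟩, h1⟩ := ht ⟨a - b, Set.sub_mem_sub ha hb, rfl⟩
    obtain ⟨_, ⟨d, hd, rfl⟩, h2⟩ := ht ⟨b - a, Set.sub_mem_sub hb ha, rfl⟩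
    simp only [vadd_eq_add] at h1 h2
    refine ⟨(2 : ℝ)⁻¹ • c + (2 : ℝ)⁻¹ • (-d),
      hB hc (hBs d hd) (by norm_num) (by norm_num) (by norm_num), ?_⟩
    have h3 : a - b = (t + ρ • c) - (t + ρ • d) := by
      rw [h1, h2]; module
    rw [h3]
    simp only
    module
  obtain ⟨u, hu⟩ := jd_bohn hn (hB.smul (2 * ρ)) (hBc.smul (2 * ρ))
    ⟨0, interior_subset hB0, by simp⟩ (by
      rintro _ ⟨z, hz, rfl⟩
      exact ⟨-z, hBs z hz, by simp⟩) hdiff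
  have hle : circumradius K C ≤ (n : ℝ) / (n + 1) * (2 * ρ) := by
    refine jd_circ_le u (by positivity) (fun a ha => ?_)
    obtain ⟨_, ⟨d, hd, rfl⟩, h⟩ := hu a ha
    refine ⟨_, ⟨d, hd.1, rfl⟩, ?_⟩
    rw [h]
    simp [smul_smul]
  calc ((n : ℝ) + 1) / (2 * n) * circumradius K C
      ≤ ((n : ℝ) + 1) / (2 * n) * ((n : ℝ) / (n + 1) * (2 * ρ)) := by gcongr
    _ = ρ := by field_simp

/-- The barycentric coordinate forms and the vertices of the simplex. -/
theorem jd_coords {n : ℕ} :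
    ∃ (f : Fin (n + 1) → EuclideanSpace ℝ (Fin n) →L[ℝ] ℝ)
      (w : Fin (n + 1) → EuclideanSpace ℝ (Fin n)),
      (∀ x, ∑ i, f i x = 0) ∧ (∀ i j, f j (w i) = if i = j then -(n : ℝ) else 1) ∧
      (∀ x (j : Fin n), f j.castSucc x = x j) := by
  let f : Fin (n + 1) → EuclideanSpace ℝ (Fin n) →L[ℝ] ℝ :=
    Fin.lastCases (-∑ i, EuclideanSpace.proj i) (fun i => EuclideanSpace.proj i)
  have hf1 : ∀ j : Fin n, f j.castSucc = EuclideanSpace.proj j := fun j => by simp [f]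
  have hf2 : f (Fin.last n) = -∑ i, EuclideanSpace.proj i := by simp [f]
  refine ⟨f, fun i => WithLp.toLp 2 (fun j => if i = j.castSucc then -(n : ℝ) else 1),
    ?_, ?_, ?_⟩
  · intro x
    rw [Fin.sum_univ_castSucc, hf2]
    simp [hf1]
  · intro i j
    refine Fin.lastCases ?_ (fun j => ?_) j
    · rw [hf2]
      refine Fin.lastCases ?_ (fun i => ?_) i
      · simp [(Fin.castSucc_lt_last _).ne']
      · simp [Finset.sum_ite]
        simp [Finset.filter_ne, Finset.filter_eq]
        rw [Nat.cast_sub (by have := i.pos; omega)]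
        push_cast; ring
    · rw [hf1]; simp
  · intro x j
    rw [hf1]; simp

theorem jd_part2 {n : ℕ} (hn : 2 ≤ n) (s : ℝ) (hs : s ∈ Set.Icc (1 : ℝ) (n : ℝ)) :
      ∃ K C : Set (EuclideanSpace ℝ (Fin n)),
        Convex ℝ C ∧ IsCompact C ∧ 0 ∈ interior C ∧ MinkowskiCentered C ∧ minkAsym C = s ∧
        (∃ ps : Fin (n + 1) → EuclideanSpace ℝ (Fin n),
          AffineIndependent ℝ ps ∧ K = convexHull ℝ (Set.range ps)) ∧
        DMIN K C / (2 * circumradius K C) = ((n : ℝ) + 1) / (2 * (n : ℝ)) := by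
  classical
  obtain ⟨hs1, hsn⟩ := hs
  have hs0 : 0 < s := by linarith
  have hn0 : (0 : ℝ) < n := by exact_mod_cast (by omega : 0 < n)
  obtain ⟨f, w, hsum, hw, hfx⟩ := jd_coords (n := n)
  let C : Set (EuclideanSpace ℝ (Fin n)) := {x | ∀ i, -1 ≤ f i x ∧ f i x ≤ s}
  let K : Set (EuclideanSpace ℝ (Fin n)) := convexHull ℝ (Set.range w)
  have hCconv : Convex ℝ C := by
    intro x hx y hy a b ha hb hab i
    simp only [map_add, map_smul, smul_eq_mul]
    have h1 := hx i
    have h2 := hy i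
    constructor <;> nlinarith
  have hCclosed : IsClosed C := by
    have : C = ⋂ i, (f i) ⁻¹' (Set.Icc (-1) s) := by
      ext x; simp [C]
    rw [this]
    exact isClosed_iInter fun i => isClosed_Icc.preimage (f i).continuous
  have hCcomp : IsCompact C := by
    refine Metric.isCompact_of_isClosed_isBounded hCclosed ?_
    rw [isBounded_iff_forall_norm_le]
    refine ⟨√(∑ _i : Fin n, s ^ 2), fun x hx => ?_⟩
    rw [EuclideanSpace.norm_eq]
    gcongr with i
    rw [Real.norm_eq_abs, abs_le]
    have := hx i.castSucc
    rw [hfx] at this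
    constructor <;> linarith
  have hC0 : 0 ∈ interior C := by
    refine mem_interior.2 ⟨⋂ i, (f i) ⁻¹' (Set.Ioo (-1) s), ?_, ?_, ?_⟩
    · intro x hx i
      have := Set.mem_iInter.1 hx i
      exact ⟨this.1.le, this.2.le⟩
    · exact isOpen_iInter_of_finite fun i => isOpen_Ioo.preimage (f i).continuous
    · simp [hs0]
  -- scaled points of K inside C
  have hp : ∀ i, (-(s / n)) • w i ∈ C := by
    intro i j
    have h1 : s / n ≤ 1 := by rw [div_le_one hn0]; exact hsn
    have h2 : 0 < s / n := by positivity
    rw [map_smul, hw, smul_eq_mul]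
    split_ifs
    · rw [neg_mul_neg, div_mul_cancel₀ _ hn0.ne']
      constructor <;> linarith
    · constructor <;> linarith
  have hsumt : ∀ (t : EuclideanSpace ℝ (Fin n)) (a ρ : ℝ), (∀ i, a ≤ f i t + ρ) → a ≤ ρ := by
    intro t a ρ h
    have h1 := Finset.sum_le_sum (fun i (_ : i ∈ Finset.univ) => h i)
    rw [Finset.sum_add_distrib, hsum] at h1
    simp only [Finset.sum_const, Finset.card_univ, Fintype.card_fin, nsmul_eq_mul, zero_add] at h1
    exact le_of_mul_le_mul_left h1 (by positivity)
  have hcontain : C ⊆ s • (-C) := by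
    intro x hx
    rw [Set.mem_smul_set_iff_inv_smul_mem₀ hs0.ne', Set.mem_neg]
    intro i
    rw [map_neg, map_smul, smul_eq_mul, inv_mul_eq_div]
    obtain ⟨h1, h2⟩ := hx i
    constructor
    · rw [neg_le_neg_iff, div_le_one hs0]; exact h2
    · rw [← neg_div, div_le_iff₀ hs0]; nlinarith
  have hlow : ∀ σ : ℝ, 0 ≤ σ → ∀ t : EuclideanSpace ℝ (Fin n), C ⊆ t +ᵥ σ • (-C) → s ≤ σ := by
    intro σ hσ t ht
    apply hsumt t
    intro i
    obtain ⟨_, ⟨c, hc, rfl⟩, h⟩ := ht (hp i)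
    have h' := congrArg (f i) h
    simp only [vadd_eq_add, map_add, map_smul, hw, if_true, smul_eq_mul] at h'
    rw [neg_mul_neg, div_mul_cancel₀ _ hn0.ne'] at h'
    have h2 := (hc i).1
    rw [map_neg] at h2
    nlinarith
  have hasym : minkAsym C = s := jd_circ_eq hs0.le hcontain hlow
  have hcent : MinkowskiCentered C := by
    unfold MinkowskiCentered OptCont
    rw [hasym]
    refine ⟨hcontain, jd_circ_eq zero_le_one (by simpa using hcontain) ?_⟩
    intro σ hσ t ht
    rw [smul_smul] at ht
    have := hlow (σ * s) (by positivity) t ht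
    nlinarith
  have hKf : ∀ x ∈ K, ∀ i, -(n : ℝ) ≤ f i x ∧ f i x ≤ 1 := by
    intro x hx
    have hconv : Convex ℝ {x : EuclideanSpace ℝ (Fin n) | ∀ i, -(n : ℝ) ≤ f i x ∧ f i x ≤ 1} := by
      intro x hx y hy a b ha hb hab i
      simp only [map_add, map_smul, smul_eq_mul]
      have h1 := hx i
      have h2 := hy i
      constructor <;> nlinarith
    refine convexHull_min ?_ hconv hx
    rintro _ ⟨i, rfl⟩ j
    rw [hw]
    split_ifs <;> constructor <;> linarith
  have hwK : ∀ i, w i ∈ K := fun i => subset_convexHull ℝ _ ⟨i, rfl⟩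
  have hR : circumradius K C = n := by
    refine jd_circ_eq hn0.le ?_ ?_
    · intro x hx
      rw [Set.mem_smul_set_iff_inv_smul_mem₀ hn0.ne']
      intro i
      obtain ⟨h1, h2⟩ := hKf x hx i
      rw [map_smul, smul_eq_mul, inv_mul_eq_div, le_div_iff₀ hn0, div_le_iff₀ hn0]
      constructor <;> nlinarith
    · intro σ hσ t ht
      apply hsumt (-t)
      intro i
      obtain ⟨_, ⟨c, hc, rfl⟩, h⟩ := ht (hwK i)
      have h' := congrArg (f i) h
      simp only [vadd_eq_add, map_add, map_smul, hw, if_true, smul_eq_mul] at h'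
      have h2 := (hc i).1
      rw [map_neg]
      nlinarith
  have hD : circumradius (symAM K) (symMIN C) = ((n : ℝ) + 1) / 2 := by
    refine jd_circ_eq (by positivity) ?_ ?_
    · rintro _ ⟨_, ⟨x, hx, y, hy, rfl⟩, rfl⟩
      rw [Set.mem_smul_set_iff_inv_smul_mem₀ (by positivity)]
      have hb : ∀ i, -1 ≤ f i ((((n : ℝ) + 1) / 2)⁻¹ • (2 : ℝ)⁻¹ • (x - y)) ∧
          f i ((((n : ℝ) + 1) / 2)⁻¹ • (2 : ℝ)⁻¹ • (x - y)) ≤ 1 := by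
        intro i
        obtain ⟨h1, h2⟩ := hKf x hx i
        obtain ⟨h3, h4⟩ := hKf y hy i
        rw [map_smul, map_smul, map_sub, smul_eq_mul, smul_eq_mul, inv_mul_eq_div,
          le_div_iff₀ (by positivity), div_le_iff₀ (by positivity)]
        constructor <;> linarith
      constructor
      · intro i
        exact ⟨(hb i).1, (hb i).2.trans hs1⟩
      · intro i
        rw [map_neg]
        have := hb i
        constructor <;> linarith
    · intro σ hσ t ht
      have h01 : (0 : Fin (n + 1)) ≠ Fin.last n := by
        intro h
        have := congrArg Fin.val h
        simp at this
        omega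
      obtain ⟨_, ⟨c, hc, rfl⟩, h1⟩ :=
        ht ⟨w (Fin.last n) - w 0, Set.sub_mem_sub (hwK _) (hwK 0), rfl⟩
      obtain ⟨_, ⟨d, hd, rfl⟩, h2⟩ :=
        ht ⟨w 0 - w (Fin.last n), Set.sub_mem_sub (hwK 0) (hwK _), rfl⟩
      have h1' := congrArg (f 0) h1
      have h2' := congrArg (f 0) h2
      simp only [vadd_eq_add, map_add, map_smul, map_sub, hw, if_true, smul_eq_mul,
        if_neg h01.symm] at h1' h2'
      have hc2 := (hc.2 0).1
      have hd1 := (hd.1 0).1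
      rw [map_neg] at hc2
      nlinarith
  refine ⟨K, C, hCconv, hCcomp, hC0, hcent, hasym, ⟨w, ?_, rfl⟩, ?_⟩
  · rw [affineIndependent_iff]
    intro I a ha hz j hj
    have h := congrArg (f j) hz
    simp only [map_sum, map_smul, hw, smul_eq_mul, map_zero] at h
    have h2 : ∀ i, a i * (if i = j then -(n : ℝ) else 1) =
        a i - (if i = j then ((n : ℝ) + 1) * a i else 0) := by
      intro i
      split_ifs <;> ring
    simp only [h2, Finset.sum_sub_distrib, ha, Finset.sum_ite_eq', hj, if_true] at h
    have h3 : ((n : ℝ) + 1) * a j = 0 := by linarith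
    rcases mul_eq_zero.1 h3 with h4 | h4
    · linarith
    · exact h4
  · unfold DMIN
    rw [hR, hD]
    field_simp

theorem jung_DMIN {n : ℕ} (hn : 2 ≤ n) :
    (∀ K C : Set (EuclideanSpace ℝ (Fin n)),
      Convex ℝ K → IsCompact K → K.Nonempty → (¬ ∃ p : EuclideanSpace ℝ (Fin n), K = {p}) →
      Convex ℝ C → IsCompact C → 0 ∈ interior C → MinkowskiCentered C →
      ((n : ℝ) + 1) / (2 * (n : ℝ)) ≤ DMIN K C / (2 * circumradius K C)) ∧
    ∀ sC : ℝ, sC ∈ Set.Icc (1 : ℝ) (n : ℝ) →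
      ∃ K C : Set (EuclideanSpace ℝ (Fin n)),
        Convex ℝ C ∧ IsCompact C ∧ 0 ∈ interior C ∧ MinkowskiCentered C ∧ minkAsym C = sC ∧
        (∃ ps : Fin (n + 1) → EuclideanSpace ℝ (Fin n),
          AffineIndependent ℝ ps ∧ K = convexHull ℝ (Set.range ps)) ∧
        DMIN K C / (2 * circumradius K C) = ((n : ℝ) + 1) / (2 * (n : ℝ)) :=
  ⟨fun K C _ hKc hKne hK1 hC hCc hC0 _ => jd_part1 hn K C hKc hKne hK1 hC hCc hC0,
    fun s hs => jd_part2 hn s hs⟩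
end
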